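/- arXiv:1312.2056 — 3 statements merged into one kernel-verified Lean document; each statement's English description precedes it below -/
import Mathlib

section
/- (X,T) is a weakly mixing E-system if and only if the induced hyperspace system (K(X), T_K) is an E-system. -/
open MeasureTheory Topology Set Function TopologicalSpace

noncomputable section

namespace Paper

/-- The orbit closure of a point. -/
def orbitClosure {α : Type*} [TopologicalSpace α] (T : α → α) (x : α) : Set α :=
  closure (Set.range fun n : ℕ => T^[n] x)

/-- Topological transitivity: `N(U,V)` is infinite for all non-empty open `U, V`. -/
def IsTransitive {α : Type*} [TopologicalSpace α] (T : α → α) : Prop :=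
  ∀ U V : Set α, IsOpen U → U.Nonempty → IsOpen V → V.Nonempty →
    {n : ℕ | (U ∩ T^[n] ⁻¹' V).Nonempty}.Infinite

/-- Weak mixing: the product system is transitive. -/
def IsWeaklyMixing {α : Type*} [TopologicalSpace α] (T : α → α) : Prop :=
  IsTransitive (Prod.map T T)

/-- Total transitivity. -/
def IsTotallyTransitive {α : Type*} [TopologicalSpace α] (T : α → α) : Prop :=
  ∀ n : ℕ, 0 < n → IsTransitive (T^[n])

/-- A minimal point: its orbit closure is a minimal subsystem. -/
def IsMinimalPoint {α : Type*} [TopologicalSpace α] (T : α → α) (x : α) : Prop :=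
  ∀ Y : Set α, Y.Nonempty → IsClosed Y → MapsTo T Y Y → Y ⊆ orbitClosure T x →
    Y = orbitClosure T x

def IsPeriodicPoint {α : Type*} (T : α → α) (x : α) : Prop :=
  ∃ n : ℕ, 0 < n ∧ T^[n] x = x

def IsPeriodicSystem {α : Type*} (T : α → α) : Prop :=
  ∃ m : ℕ, 0 < m ∧ T^[m] = id

def IsPointwisePeriodic {α : Type*} (T : α → α) : Prop :=
  ∀ x : α, IsPeriodicPoint T x

def IsMSystem {α : Type*} [TopologicalSpace α] (T : α → α) : Prop :=
  IsTransitive T ∧ Dense {x : α | IsMinimalPoint T x}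

def IsPSystem {α : Type*} [TopologicalSpace α] (T : α → α) : Prop :=
  IsTransitive T ∧ Dense {x : α | IsPeriodicPoint T x}

/-- An E-system: transitive with an invariant (Borel) probability measure of full support. -/
def IsESystem {α : Type*} [TopologicalSpace α] (T : α → α) : Prop :=
  IsTransitive T ∧
    let _i : MeasurableSpace α := borel α
    ∃ μ : Measure α, IsProbabilityMeasure μ ∧ μ.map T = μ ∧
      ∀ U : Set α, IsOpen U → U.Nonempty → 0 < μ U

/-- A proximal pair: the orbit closure of `(x, y)` meets the diagonal. -/
def IsProximalPair {α : Type*} [TopologicalSpace α] (T : α → α) (x y : α) : Prop :=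
  ∃ z : α, (z, z) ∈ closure (Set.range fun n : ℕ => (T^[n] x, T^[n] y))

def IsDistalPoint {α : Type*} [TopologicalSpace α] (T : α → α) (x : α) : Prop :=
  ∀ y ∈ orbitClosure T x, IsProximalPair T x y → y = x

def IsDistalSystem {α : Type*} [TopologicalSpace α] (T : α → α) : Prop :=
  ∀ x y : α, IsProximalPair T x y → x = y

/-- The induced map on the hyperspace of non-empty compact (= closed) subsets. -/
def TK {α : Type*} [TopologicalSpace α] (T : α → α) (hT : Continuous T)
    (C : NonemptyCompacts α) : NonemptyCompacts α :=
  ⟨⟨T '' (C : Set α), C.isCompact.image hT⟩, C.nonempty.image T⟩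

/-- The induced map on the space of Borel probability measures. -/
def TM {α : Type*} [TopologicalSpace α] [MeasurableSpace α] [BorelSpace α] (T : α → α)
    (hT : Continuous T) (μ : ProbabilityMeasure α) : ProbabilityMeasure α :=
  μ.map hT.measurable.aemeasurable

/-- Almost dense periodic sets. -/
def AlmostDensePeriodicSets {α : Type*} [TopologicalSpace α] (T : α → α) : Prop :=
  let _i : MeasurableSpace α := borel α
  ∀ U : Set α, IsOpen U → U.Nonempty → ∀ ε : ℝ, 0 < ε →
    ∃ k : ℕ, 0 < k ∧ ∃ μ : Measure α, IsProbabilityMeasure μ ∧ μ.map (T^[k]) = μ ∧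
      μ Uᶜ < ENNReal.ofReal ε

def IsAlmostHYSystem {α : Type*} [TopologicalSpace α] (T : α → α) : Prop :=
  IsTotallyTransitive T ∧ AlmostDensePeriodicSets T

def IsFactorMap {α β : Type*} [TopologicalSpace α] [TopologicalSpace β]
    (T : α → α) (S : β → β) (π : α → β) : Prop :=
  Continuous π ∧ Surjective π ∧ π ∘ T = S ∘ π

def IsJoining {α β : Type*} [TopologicalSpace α] [TopologicalSpace β]
    (T : α → α) (S : β → β) (J : Set (α × β)) : Prop :=
  J.Nonempty ∧ IsClosed J ∧ MapsTo (Prod.map T S) J J ∧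
    Prod.fst '' J = Set.univ ∧ Prod.snd '' J = Set.univ

def AreDisjoint {α β : Type*} [TopologicalSpace α] [TopologicalSpace β]
    (T : α → α) (S : β → β) : Prop :=
  ∀ J : Set (α × β), IsJoining T S J → J = Set.univ

def IsMinimalSystem {β : Type*} [TopologicalSpace β] (S : β → β) : Prop :=
  ∀ Y : Set β, Y.Nonempty → IsClosed Y → MapsTo S Y Y → Y = Set.univ

/-- Disjoint from every minimal system (on a compact metric space). -/
def DisjointFromAllMinimal {α : Type*} [TopologicalSpace α] (T : α → α) : Prop :=
  ∀ (β : Type) (_ : MetricSpace β) (_ : CompactSpace β) (S : β → β),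
    Continuous S → Surjective S → IsMinimalSystem S → AreDisjoint T S

section WeakMixing

variable {X : Type*} [TopologicalSpace X] {T : X → X}

/-- Furstenberg's intersection lemma for two pairs of open sets. -/
theorem IsWeaklyMixing.exists_hitting_subset₂ (hT : Continuous T) (hwm : IsWeaklyMixing T)
    {U₁ V₁ U₂ V₂ : Set X} (hU₁ : IsOpen U₁) (nU₁ : U₁.Nonempty) (hV₁ : IsOpen V₁)
    (nV₁ : V₁.Nonempty) (hU₂ : IsOpen U₂) (nU₂ : U₂.Nonempty) (hV₂ : IsOpen V₂)
    (nV₂ : V₂.Nonempty) :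
    ∃ U V : Set X, IsOpen U ∧ U.Nonempty ∧ IsOpen V ∧ V.Nonempty ∧
      ∀ k : ℕ, (U ∩ T^[k] ⁻¹' V).Nonempty →
        (U₁ ∩ T^[k] ⁻¹' V₁).Nonempty ∧ (U₂ ∩ T^[k] ⁻¹' V₂).Nonempty := by
  obtain ⟨n, ⟨x, y⟩, ⟨hx, hy⟩, hxy⟩ := (hwm (U₁ ×ˢ V₁) (U₂ ×ˢ V₂) (hU₁.prod hV₁) (nU₁.prod nV₁)
    (hU₂.prod hV₂) (nU₂.prod nV₂)).nonempty
  rw [Prod.map_iterate] at hxy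
  refine ⟨U₁ ∩ T^[n] ⁻¹' U₂, V₁ ∩ T^[n] ⁻¹' V₂, hU₁.inter (hU₂.preimage (hT.iterate n)),
    ⟨x, hx, hxy.1⟩, hV₁.inter (hV₂.preimage (hT.iterate n)), ⟨y, hy, hxy.2⟩, ?_⟩
  rintro k ⟨z, ⟨hz₁, hz₂⟩, hz₃, hz₄⟩
  refine ⟨⟨z, hz₁, hz₃⟩, T^[n] z, hz₂, ?_⟩
  rw [mem_preimage] at hz₄ ⊢
  rwa [← iterate_add_apply, add_comm, iterate_add_apply]

/-- Furstenberg's intersection lemma for finitely many pairs of open sets. -/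
theorem IsWeaklyMixing.exists_hitting_subset [Nonempty X] (hT : Continuous T)
    (hwm : IsWeaklyMixing T) {ι : Type*} (s : Finset ι) {U V : ι → Set X}
    (hU : ∀ i, IsOpen (U i)) (nU : ∀ i, (U i).Nonempty) (hV : ∀ i, IsOpen (V i))
    (nV : ∀ i, (V i).Nonempty) :
    ∃ U' V' : Set X, IsOpen U' ∧ U'.Nonempty ∧ IsOpen V' ∧ V'.Nonempty ∧
      ∀ k : ℕ, (U' ∩ T^[k] ⁻¹' V').Nonempty → ∀ i ∈ s, (U i ∩ T^[k] ⁻¹' V i).Nonempty := by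
  classical
  induction s using Finset.induction_on with
  | empty => exact ⟨univ, univ, isOpen_univ, univ_nonempty, isOpen_univ, univ_nonempty, by simp⟩
  | insert i s _ ih =>
    obtain ⟨U₁, V₁, hU₁, nU₁, hV₁, nV₁, h₁⟩ := ih
    obtain ⟨U', V', hU', nU', hV', nV', h'⟩ := hwm.exists_hitting_subset₂ hT (hU i) (nU i) (hV i)
      (nV i) hU₁ nU₁ hV₁ nV₁
    refine ⟨U', V', hU', nU', hV', nV', fun k hk => ?_⟩
    rw [Finset.forall_mem_insert]
    exact ⟨(h' k hk).1, h₁ k (h' k hk).2⟩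

end WeakMixing

section Hyperspace

variable {X : Type*} [TopologicalSpace X] {T : X → X}

theorem continuous_TK (hT : Continuous T) : Continuous (TK T hT) :=
  hT.nonemptyCompacts_map

theorem coe_iterate_TK (hT : Continuous T) (n : ℕ) (C : NonemptyCompacts X) :
    ((TK T hT)^[n] C : Set X) = T^[n] '' C := by
  induction n with
  | zero => simp
  | succ n ih =>
    rw [iterate_succ_apply', iterate_succ', image_comp, ← ih]
    rfl

/-- The finite set of values of a finite family of points, as a point of the hyperspace. -/
def rangeCompacts {ι : Type*} [Finite ι] [Nonempty ι] (x : ι → X) : NonemptyCompacts X :=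
  ⟨⟨range x, (finite_range x).isCompact⟩, range_nonempty x⟩

theorem continuous_rangeCompacts {ι : Type*} [Finite ι] [Nonempty ι] :
    Continuous (rangeCompacts : (ι → X) → NonemptyCompacts X) :=
  letI := TopologicalSpace.vietoris X
  NonemptyCompacts.isEmbedding_coe.continuous_iff.mpr vietoris.continuous_range_of_finite

theorem rangeCompacts_comp {ι κ : Type*} [Finite ι] [Nonempty ι] [Finite κ] [Nonempty κ]
    {g : κ → ι} (hg : Surjective g) (x : ι → X) : rangeCompacts (x ∘ g) = rangeCompacts x :=
  SetLike.coe_injective (hg.range_comp x)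

theorem TK_rangeCompacts (hT : Continuous T) {ι : Type*} [Finite ι] [Nonempty ι] (x : ι → X) :
    TK T hT (rangeCompacts x) = rangeCompacts (T ∘ x) :=
  SetLike.coe_injective (range_comp T x).symm

theorem iterate_TK_rangeCompacts (hT : Continuous T) {ι : Type*} [Finite ι] [Nonempty ι]
    (n : ℕ) (x : ι → X) : (TK T hT)^[n] (rangeCompacts x) = rangeCompacts (T^[n] ∘ x) :=
  SetLike.coe_injective ((coe_iterate_TK hT n _).trans (range_comp _ x).symm)

theorem exists_rangeCompacts_mem {𝒰 : Set (NonemptyCompacts X)} (h𝒰 : IsOpen 𝒰)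
    (n𝒰 : 𝒰.Nonempty) : ∃ (n : ℕ) (x : Fin (n + 1) → X), rangeCompacts x ∈ 𝒰 := by
  obtain ⟨C, hC, hC𝒰⟩ := NonemptyCompacts.dense_setOfPred_finite.exists_mem_open h𝒰 n𝒰
  have : Finite C := hC
  have : Nonempty C := C.nonempty.to_subtype
  obtain ⟨n, ⟨e⟩⟩ := Finite.exists_equiv_fin C
  obtain _ | n := n
  · exact (e (Classical.arbitrary C)).elim0
  · refine ⟨n, fun i => e.symm i, ?_⟩
    convert hC𝒰
    refine SetLike.coe_injective ((e.symm.surjective.range_comp _).trans ?_)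
    exact Subtype.range_coe

theorem IsTransitive.TK [Nonempty X] (hT : Continuous T) (ht : IsTransitive T)
    (hwm : IsWeaklyMixing T) : IsTransitive (TK T hT) := by
  intro 𝒰 𝒱 h𝒰 n𝒰 h𝒱 n𝒱
  obtain ⟨n, x, hx⟩ := exists_rangeCompacts_mem h𝒰 n𝒰
  obtain ⟨m, y, hy⟩ := exists_rangeCompacts_mem h𝒱 n𝒱
  let ι := Fin (n + 1) × Fin (m + 1)
  have hx' : rangeCompacts (fun i : ι => x i.1) ∈ 𝒰 :=
    (rangeCompacts_comp (g := (Prod.fst : ι → Fin (n + 1))) Prod.fst_surjective x).symm ▸ hx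
  have hy' : rangeCompacts (fun i : ι => y i.2) ∈ 𝒱 :=
    (rangeCompacts_comp (g := (Prod.snd : ι → Fin (m + 1))) Prod.snd_surjective y).symm ▸ hy
  obtain ⟨U, hU, hU𝒰⟩ := isOpen_pi_iff'.mp (h𝒰.preimage continuous_rangeCompacts) _ hx'
  obtain ⟨V, hV, hV𝒱⟩ := isOpen_pi_iff'.mp (h𝒱.preimage continuous_rangeCompacts) _ hy'
  obtain ⟨U', V', hU', nU', hV', nV', h⟩ := hwm.exists_hitting_subset hT Finset.univ
    (fun i => (hU i).1) (fun i => ⟨_, (hU i).2⟩) (fun i => (hV i).1) (fun i => ⟨_, (hV i).2⟩)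
  refine (ht U' V' hU' nU' hV' nV').mono fun k hk => ?_
  choose z hzU hzV using fun i => h k hk i (Finset.mem_univ i)
  refine ⟨rangeCompacts z, hU𝒰 fun i _ => hzU i, ?_⟩
  rw [mem_preimage, iterate_TK_rangeCompacts]
  exact hV𝒱 fun i _ => hzV i

theorem IsTransitive.isWeaklyMixing_of_TK (hT : Continuous T) (hTs : Surjective T)
    (h : IsTransitive (Paper.TK T hT)) : IsWeaklyMixing T := by
  have key : ∀ U V W : Set X, IsOpen U → U.Nonempty → IsOpen V → V.Nonempty → IsOpen W →
      W.Nonempty →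
      {k : ℕ | (U ∩ T^[k] ⁻¹' V).Nonempty ∧ (U ∩ T^[k] ⁻¹' W).Nonempty}.Infinite := by
    rintro U V W hU ⟨x, hx⟩ hV ⟨y, hy⟩ hW ⟨z, hz⟩
    refine (h _ _ (NonemptyCompacts.isOpen_subsets_of_isOpen hU) ⟨{x}, by simpa using hx⟩
      ((NonemptyCompacts.isOpen_inter_nonempty_of_isOpen hV).inter
        (NonemptyCompacts.isOpen_inter_nonempty_of_isOpen hW))
      ⟨{y} ⊔ {z}, ⟨y, by simp, hy⟩, ⟨z, by simp, hz⟩⟩).mono ?_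
    rintro k ⟨C, hC, h₁, h₂⟩
    rw [mem_ofPred_eq, coe_iterate_TK] at h₁ h₂
    obtain ⟨_, ⟨a, ha, rfl⟩, ha'⟩ := h₁
    obtain ⟨_, ⟨b, hb, rfl⟩, hb'⟩ := h₂
    exact ⟨⟨a, hC ha, ha'⟩, ⟨b, hC hb, hb'⟩⟩
  intro 𝒰 𝒱 h𝒰 ⟨⟨x₁, x₂⟩, hx⟩ h𝒱 ⟨⟨y₁, y₂⟩, hy⟩
  obtain ⟨U₁, U₂, hU₁, hU₂, hx₁, hx₂, hU⟩ := isOpen_prod_iff.mp h𝒰 _ _ hx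
  obtain ⟨V₁, V₂, hV₁, hV₂, hy₁, hy₂, hV⟩ := isOpen_prod_iff.mp h𝒱 _ _ hy
  obtain ⟨n, ⟨a, ha₁, ha₂⟩, -⟩ := (key U₁ U₂ U₂ hU₁ ⟨_, hx₁⟩ hU₂ ⟨_, hx₂⟩ hU₂ ⟨_, hx₂⟩).nonempty
  obtain ⟨w, hw⟩ := hTs.iterate n y₂
  refine (key (U₁ ∩ T^[n] ⁻¹' U₂) V₁ (T^[n] ⁻¹' V₂) (hU₁.inter (hU₂.preimage (hT.iterate n)))
    ⟨a, ha₁, ha₂⟩ hV₁ ⟨_, hy₁⟩ (hV₂.preimage (hT.iterate n))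
    ⟨w, by rwa [mem_preimage, hw]⟩).mono ?_
  rintro k ⟨⟨b, hb, hb'⟩, ⟨c, hc, hc'⟩⟩
  refine ⟨(b, T^[n] c), hU ⟨hb.1, hc.2⟩, ?_⟩
  rw [mem_preimage, Prod.map_iterate]
  refine hV ⟨hb', ?_⟩
  rw [mem_preimage, mem_preimage] at hc'
  change T^[k] (T^[n] c) ∈ V₂
  rwa [← iterate_add_apply, add_comm, iterate_add_apply]

end Hyperspace

section HyperspaceMeasure

variable {X : Type*} [TopologicalSpace X] [SecondCountableTopology X] [MeasurableSpace X]
  [BorelSpace X] [MeasurableSpace (NonemptyCompacts X)] [BorelSpace (NonemptyCompacts X)]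

/-- The law of the set of values of a sample of independent `μ`-distributed points, the sample
having size `n + 1` with probability `2⁻¹ ^ (n + 1)`. -/
def randomFiniteSet (μ : Measure X) : Measure (NonemptyCompacts X) :=
  Measure.sum fun n : ℕ =>
    (2⁻¹ : ENNReal) ^ (n + 1) • (Measure.pi fun _ : Fin (n + 1) => μ).map rangeCompacts

instance (μ : Measure X) [IsProbabilityMeasure μ] : IsProbabilityMeasure (randomFiniteSet μ) := by
  constructor
  have h (n : ℕ) : (Measure.pi fun _ : Fin (n + 1) => μ).map rangeCompacts univ = 1 := by
    rw [Measure.map_apply continuous_rangeCompacts.measurable .univ, preimage_univ, measure_univ]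
  simp only [randomFiniteSet, Measure.sum_apply _ MeasurableSet.univ, Measure.smul_apply, h,
    smul_eq_mul, mul_one]
  rw [ENNReal.tsum_geometric_add_one, ENNReal.one_sub_inv_two, inv_inv]
  exact ENNReal.inv_mul_cancel two_ne_zero ENNReal.ofNat_ne_top

theorem map_TK_randomFiniteSet {T : X → X} (hT : Continuous T) {μ : Measure X}
    [IsProbabilityMeasure μ] (hμ : μ.map T = μ) :
    (randomFiniteSet μ).map (TK T hT) = randomFiniteSet μ := by
  have hTK := (continuous_TK hT).measurable
  rw [randomFiniteSet, Measure.map_sum hTK.aemeasurable]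
  congr 1
  ext1 n
  have hpi := measurePreserving_pi (fun _ : Fin (n + 1) => μ) (fun _ => μ)
    (fun _ => (⟨hT.measurable, hμ⟩ : MeasurePreserving T μ μ))
  rw [Measure.map_smul, Measure.map_map hTK continuous_rangeCompacts.measurable]
  conv_rhs => rw [← hpi.map_eq, Measure.map_map continuous_rangeCompacts.measurable hpi.measurable]
  congr 2
  ext1 x
  exact TK_rangeCompacts hT x

theorem randomFiniteSet_pos (μ : Measure X) [IsProbabilityMeasure μ] [μ.IsOpenPosMeasure]
    {𝒰 : Set (NonemptyCompacts X)} (h𝒰 : IsOpen 𝒰) (n𝒰 : 𝒰.Nonempty) :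
    0 < randomFiniteSet μ 𝒰 := by
  obtain ⟨n, x, hx⟩ := exists_rangeCompacts_mem h𝒰 n𝒰
  have h := (h𝒰.preimage continuous_rangeCompacts).measure_pos
    (Measure.pi fun _ : Fin (n + 1) => μ) ⟨x, hx⟩
  refine lt_of_lt_of_le ?_ (Measure.le_sum _ n 𝒰)
  rw [Measure.smul_apply, Measure.map_apply continuous_rangeCompacts.measurable h𝒰.measurableSet]
  exact ENNReal.mul_pos (pow_ne_zero _ (by simp)) h.ne'

end HyperspaceMeasure

section SupOn

variable {X : Type*} [TopologicalSpace X]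

/-- The supremum of a continuous function over a point of the hyperspace. -/
def supOn (f : C(X, ℝ)) (C : NonemptyCompacts X) : ℝ :=
  sSup (f '' C)

theorem supOn_le_iff {f : C(X, ℝ)} {C : NonemptyCompacts X} {a : ℝ} :
    supOn f C ≤ a ↔ ∀ x ∈ C, f x ≤ a := by
  rw [supOn, csSup_le_iff (C.isCompact.image f.continuous).bddAbove (C.nonempty.image f),
    forall_mem_image]
  rfl

theorem le_supOn (f : C(X, ℝ)) {C : NonemptyCompacts X} {x : X} (hx : x ∈ C) : f x ≤ supOn f C :=
  supOn_le_iff.mp le_rfl x hx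

theorem supOn_lt_iff {f : C(X, ℝ)} {C : NonemptyCompacts X} {a : ℝ} :
    supOn f C < a ↔ ∀ x ∈ C, f x < a :=
  C.isCompact.sSup_lt_iff_of_continuous C.nonempty f.continuous.continuousOn a

theorem lt_supOn_iff {f : C(X, ℝ)} {C : NonemptyCompacts X} {a : ℝ} :
    a < supOn f C ↔ ∃ x ∈ C, a < f x := by
  simpa using (supOn_le_iff (f := f) (C := C) (a := a)).not

theorem continuous_supOn (f : C(X, ℝ)) : Continuous (supOn f) := by
  refine OrderTopology.continuous_iff.mpr fun a => ⟨?_, ?_⟩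
  · convert NonemptyCompacts.isOpen_inter_nonempty_of_isOpen
      ((isOpen_Ioi (a := a)).preimage f.continuous)
    exact Set.ext fun _ => lt_supOn_iff
  · convert NonemptyCompacts.isOpen_subsets_of_isOpen
      ((isOpen_Iio (a := a)).preimage f.continuous)
    exact Set.ext fun _ => supOn_lt_iff

theorem supOn_add_le (f g : C(X, ℝ)) (C : NonemptyCompacts X) :
    supOn (f + g) C ≤ supOn f C + supOn g C :=
  supOn_le_iff.mpr fun _ hx => add_le_add (le_supOn f hx) (le_supOn g hx)

theorem supOn_const (c : ℝ) (C : NonemptyCompacts X) : supOn (.const X c) C = c :=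
  have ⟨_, hx⟩ := C.nonempty
  le_antisymm (supOn_le_iff.mpr fun _ _ => le_rfl) (le_supOn (.const X c) hx)

theorem supOn_smul {c : ℝ} (hc : 0 < c) (f : C(X, ℝ)) (C : NonemptyCompacts X) :
    supOn (c • f) C = c * supOn f C := by
  refine eq_of_forall_ge_iff fun a => ?_
  rw [← le_div_iff₀' hc, supOn_le_iff, supOn_le_iff]
  exact forall₂_congr fun x _ => (le_div_iff₀' hc).symm

theorem supOn_comp {T : X → X} (hT : Continuous T) (f : C(X, ℝ)) (C : NonemptyCompacts X) :
    supOn (f.comp ⟨T, hT⟩) C = supOn f (TK T hT C) := by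
  simp only [supOn, TK, ContinuousMap.coe_comp, image_comp]
  rfl

end SupOn

section InvariantMeasure

variable {X : Type*} [TopologicalSpace X] [CompactSpace X]

/-- The Riesz–Markov–Kakutani theorem for functionals on `C(X, ℝ)`. -/
theorem exists_measure_integral_eq [T2Space X] [MeasurableSpace X] [BorelSpace X]
    (L : C(X, ℝ) →ₗ[ℝ] ℝ)
    (hL : ∀ f, 0 ≤ f → 0 ≤ L f) :
    ∃ ν : Measure X, IsFiniteMeasure ν ∧ ∀ f : C(X, ℝ), ∫ x, f x ∂ν = L f := by
  let Λ : CompactlySupportedContinuousMap X ℝ →ₚ[ℝ] ℝ := PositiveLinearMap.mk₀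
    { toFun := fun f => L f.toContinuousMap
      map_add' := fun f g => L.map_add f.toContinuousMap g.toContinuousMap
      map_smul' := fun c f => L.map_smul c f.toContinuousMap } fun f hf => hL _ hf
  exact ⟨RealRMK.rieszMeasure Λ, inferInstance, fun f =>
    RealRMK.integral_rieszMeasure Λ (CompactlySupportedContinuousMap.continuousMapEquiv f)⟩

/-- By the Hahn–Banach theorem, there is a `T`-invariant linear functional dominated by the
average of `supOn` with respect to an invariant measure on the hyperspace. -/
theorem exists_invariant_functional [MeasurableSpace (NonemptyCompacts X)]
    [BorelSpace (NonemptyCompacts X)] {T : X → X} (hT : Continuous T)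
    {μ : Measure (NonemptyCompacts X)} [IsFiniteMeasure μ]
    (hμ : μ.map (TK T hT) = μ) :
    ∃ L : C(X, ℝ) →ₗ[ℝ] ℝ, (∀ f, L (f.comp ⟨T, hT⟩) = L f) ∧ ∀ f, L f ≤ ∫ C, supOn f C ∂μ := by
  have hint (f : C(X, ℝ)) : Integrable (supOn f) μ :=
    (continuous_supOn f).integrable_of_hasCompactSupport (.of_compactSpace _)
  have hadd (f g : C(X, ℝ)) :
      ∫ C, supOn (f + g) C ∂μ ≤ ∫ C, supOn f C ∂μ + ∫ C, supOn g C ∂μ := by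
    rw [← integral_add (hint f) (hint g)]
    exact integral_mono (hint _) ((hint f).add (hint g)) (supOn_add_le f g)
  have hcomp (f : C(X, ℝ)) : ∫ C, supOn (f.comp ⟨T, hT⟩) C ∂μ = ∫ C, supOn f C ∂μ := by
    simp only [supOn_comp]
    conv_rhs => rw [← hμ]
    exact (integral_map (continuous_TK hT).aemeasurable
      (continuous_supOn f).aestronglyMeasurable).symm
  let D : C(X, ℝ) →ₗ[ℝ] C(X, ℝ) :=
    LinearMap.id - (ContinuousMap.compRightAlgHom ℝ ℝ ⟨T, hT⟩).toLinearMap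
  have hD (f : C(X, ℝ)) : D f = f - f.comp ⟨T, hT⟩ := rfl
  obtain ⟨L, hL₀, hL⟩ := exists_extension_of_le_sublinear ⟨LinearMap.range D, 0⟩
    (fun f => ∫ C, supOn f C ∂μ)
    (fun c hc f => by simp only [supOn_smul hc, integral_const_mul]) hadd (by
      rintro ⟨_, f, rfl⟩
      have := hadd (D f) (f.comp ⟨T, hT⟩)
      rw [hD, sub_add_cancel, hcomp] at this
      simpa [hD] using this)
  refine ⟨L, fun f => ?_, hL⟩
  have := hL₀ ⟨D f, f, rfl⟩
  rw [← sub_eq_zero, ← neg_eq_zero, neg_sub, ← map_sub]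
  exact this

end InvariantMeasure

theorem exists_invariant_measure_of_TK {X : Type*} [MetricSpace X] [CompactSpace X]
    [MeasurableSpace X] [BorelSpace X] [MeasurableSpace (NonemptyCompacts X)]
    [BorelSpace (NonemptyCompacts X)] {T : X → X} (hT : Continuous T)
    {μ : Measure (NonemptyCompacts X)} [IsProbabilityMeasure μ] [μ.IsOpenPosMeasure]
    (hμ : μ.map (TK T hT) = μ) :
    ∃ ν : Measure X, IsProbabilityMeasure ν ∧ ν.map T = ν ∧
      ∀ U : Set X, IsOpen U → U.Nonempty → 0 < ν U := by
  obtain ⟨L, hLT, hL⟩ := exists_invariant_functional hT hμ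
  have hle (f : C(X, ℝ)) : ∫ C, -supOn (-f) C ∂μ ≤ L f := by
    rw [integral_neg, neg_le, ← map_neg]
    exact hL (-f)
  obtain ⟨ν, _, hν⟩ := exists_measure_integral_eq L fun f hf =>
    (integral_nonneg fun C => neg_nonneg.mpr (supOn_le_iff.mpr fun x _ =>
      neg_nonpos.mpr (hf x))).trans (hle f)
  refine ⟨ν, ⟨?_⟩, ?_, fun U hU ⟨x, hx⟩ => ?_⟩
  · have h₁ : L 1 = 1 := by
      have hone (C : NonemptyCompacts X) : supOn 1 C = 1 := supOn_const 1 C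
      have hneg (C : NonemptyCompacts X) : supOn (-1) C = -1 := supOn_const (-1) C
      refine le_antisymm ((hL 1).trans_eq ?_) (le_trans (le_of_eq ?_) (hle 1))
      · simp [hone]
      · simp [hneg]
    have := (hν 1).trans h₁
    simpa [measureReal_def, ENNReal.toReal_eq_one_iff] using this
  · refine ext_of_forall_integral_eq_of_IsFiniteMeasure fun f => ?_
    rw [integral_map hT.aemeasurable f.continuous.aestronglyMeasurable]
    exact (hν (f.toContinuousMap.comp ⟨T, hT⟩)).trans
      ((hLT f.toContinuousMap).trans (hν f.toContinuousMap).symm)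
  · obtain ⟨f, hf₀, hf₁, hf⟩ := exists_continuous_zero_one_of_isClosed hU.isClosed_compl
      (isClosed_singleton (x := x)) (by simpa using hx)
    have hpos : 0 < L f := by
      refine lt_of_lt_of_le ?_ (hle f)
      refine (continuous_supOn (-f)).neg.integral_pos_of_hasCompactSupport_nonneg_nonzero
        (x := {x}) (.of_compactSpace _) (fun C => ?_) ?_
      · exact neg_nonneg.mpr (supOn_le_iff.mpr fun y _ => neg_nonpos.mpr (hf y).1)
      · have := hf₁ (mem_singleton x)
        simp [supOn, this]
    by_contra h
    have h0 : ν U = 0 := by simpa using h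
    rw [← hν, integral_eq_zero_of_ae] at hpos
    · exact hpos.false
    · filter_upwards [measure_eq_zero_iff_ae_notMem.mp h0] with y hy using hf₀ hy

theorem wm_Esystem_iff_hyperspace_Esystem {X : Type*} [MetricSpace X] [CompactSpace X]
    (T : X → X) (hT : Continuous T) (hTs : Surjective T) :
    (IsWeaklyMixing T ∧ IsESystem T) ↔ IsESystem (TK T hT) := by
  let _ : MeasurableSpace X := borel X
  have _ : BorelSpace X := ⟨rfl⟩
  let _ : MeasurableSpace (NonemptyCompacts X) := borel (NonemptyCompacts X)
  have _ : BorelSpace (NonemptyCompacts X) := ⟨rfl⟩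
  constructor
  · rintro ⟨hwm, ht, μ, hμ, hμT, hpos⟩
    have : Nonempty X := μ.nonempty_of_neZero
    have : μ.IsOpenPosMeasure := ⟨fun U hU nU => (hpos U hU nU).ne'⟩
    exact ⟨ht.TK hT hwm, randomFiniteSet μ, inferInstance, map_TK_randomFiniteSet hT hμT,
      fun _ => randomFiniteSet_pos μ⟩
  · rintro ⟨ht, μ, hμ, hμT, hpos⟩
    have : μ.IsOpenPosMeasure := ⟨fun U hU nU => (hpos U hU nU).ne'⟩
    have hwm := ht.isWeaklyMixing_of_TK hT hTs
    refine ⟨hwm, fun U V hU nU hV nV => ?_, exists_invariant_measure_of_TK hT hμT⟩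
    refine (hwm _ _ (hU.prod hU) (nU.prod nU) (hV.prod hV) (nV.prod nV)).mono ?_
    rintro k ⟨⟨x, y⟩, hx, hxy⟩
    rw [mem_preimage, Prod.map_iterate] at hxy
    exact ⟨x, hx.1, hxy.1⟩

end Paper
end
end

section
/- A topological dynamical system (X,T) is weakly mixing if and only if the induced system (M(X), T_M) is transitive, if and only if (M(X), T_M) is weakly mixing. -/
open MeasureTheory Topology Set Function TopologicalSpace

noncomputable section

namespace Paper

/-- The set `N(U, V)` of times at which some point of `U` visits `V`. -/
def visitTimes {α : Type*} (T : α → α) (U V : Set α) : Set ℕ :=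
  {n : ℕ | (U ∩ T^[n] ⁻¹' V).Nonempty}

theorem mem_visitTimes {α : Type*} {T : α → α} {U V : Set α} {n : ℕ} :
    n ∈ visitTimes T U V ↔ ∃ x ∈ U, T^[n] x ∈ V :=
  Iff.rfl

theorem visitTimes_prodMap {α β : Type*} (T : α → α) (S : β → β) (U V : Set α) (U' V' : Set β) :
    visitTimes (Prod.map T S) (U ×ˢ U') (V ×ˢ V') = visitTimes T U V ∩ visitTimes S U' V' := by
  ext n
  simp only [mem_visitTimes, Set.mem_inter_iff, Prod.exists, Set.mem_prod, Prod.map_iterate,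
    Prod.map_apply]
  constructor
  · rintro ⟨x, y, ⟨hx, hy⟩, hx', hy'⟩
    exact ⟨⟨x, hx, hx'⟩, y, hy, hy'⟩
  · rintro ⟨⟨x, hx, hx'⟩, y, hy, hy'⟩
    exact ⟨x, y, ⟨hx, hy⟩, hx', hy'⟩

theorem visitTimes_mono {α : Type*} {T : α → α} {U U' V V' : Set α} (hU : U ⊆ U') (hV : V ⊆ V') :
    visitTimes T U V ⊆ visitTimes T U' V' := by
  rintro n ⟨x, hx, hx'⟩
  exact ⟨x, hU hx, hV hx'⟩

theorem visitTimes_inter_preimage_subset {α : Type*} (T : α → α) (U V U' V' : Set α) (k : ℕ) :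
    visitTimes T (U ∩ T^[k] ⁻¹' U') (V ∩ T^[k] ⁻¹' V') ⊆
      visitTimes T U V ∩ visitTimes T U' V' := by
  rintro n ⟨x, hx, hx'⟩
  refine ⟨⟨x, hx.1, hx'.1⟩, T^[k] x, hx.2, ?_⟩
  have h : T^[k] (T^[n] x) ∈ V' := hx'.2
  rwa [Set.mem_preimage, ← Function.iterate_add_apply, Nat.add_comm, Function.iterate_add_apply]

section Topological

variable {α : Type*} [TopologicalSpace α] {T : α → α}

theorem isWeaklyMixing_iff :
    IsWeaklyMixing T ↔ ∀ U V U' V' : Set α, IsOpen U → U.Nonempty → IsOpen V → V.Nonempty →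
      IsOpen U' → U'.Nonempty → IsOpen V' → V'.Nonempty →
      (visitTimes T U V ∩ visitTimes T U' V').Infinite := by
  constructor
  · intro h U V U' V' hU hU₀ hV hV₀ hU' hU₀' hV' hV₀'
    rw [← visitTimes_prodMap]
    exact h _ _ (hU.prod hU') (hU₀.prod hU₀') (hV.prod hV') (hV₀.prod hV₀')
  · rintro h W W' hW ⟨⟨x, y⟩, hxy⟩ hW' ⟨⟨x', y'⟩, hxy'⟩
    obtain ⟨U, U', hU, hU', hx, hy, hUW⟩ := isOpen_prod_iff.1 hW x y hxy
    obtain ⟨V, V', hV, hV', hx', hy', hVW⟩ := isOpen_prod_iff.1 hW' x' y' hxy'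
    refine (h U V U' V' hU ⟨x, hx⟩ hV ⟨x', hx'⟩ hU' ⟨y, hy⟩ hV' ⟨y', hy'⟩).mono ?_
    rw [← visitTimes_prodMap]
    exact visitTimes_mono hUW hVW

theorem IsWeaklyMixing.isTransitive (h : IsWeaklyMixing T) : IsTransitive T := by
  intro U V hU hU₀ hV hV₀
  exact (isWeaklyMixing_iff.1 h U V U V hU hU₀ hV hV₀ hU hU₀ hV hV₀).mono Set.inter_subset_left

/-- Furstenberg's intersection lemma for finite families. -/
theorem IsWeaklyMixing.exists_visitTimes_subset_iInter [Nonempty α] (hT : Continuous T)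
    (h : IsWeaklyMixing T) {ι : Type*} (s : Finset ι) (A B : ι → Set α)
    (hA : ∀ i ∈ s, IsOpen (A i) ∧ (A i).Nonempty) (hB : ∀ i ∈ s, IsOpen (B i) ∧ (B i).Nonempty) :
    ∃ U V : Set α, IsOpen U ∧ U.Nonempty ∧ IsOpen V ∧ V.Nonempty ∧
      visitTimes T U V ⊆ ⋂ i ∈ s, visitTimes T (A i) (B i) := by
  classical
  induction s using Finset.induction_on with
  | empty => exact ⟨univ, univ, isOpen_univ, univ_nonempty, isOpen_univ, univ_nonempty, by simp⟩
  | insert i s _ ih =>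
    obtain ⟨U, V, hU, hU₀, hV, hV₀, hUV⟩ := ih (fun j hj => hA j (Finset.mem_insert_of_mem hj))
      (fun j hj => hB j (Finset.mem_insert_of_mem hj))
    obtain ⟨hAi, hAi₀⟩ := hA i (Finset.mem_insert_self i s)
    obtain ⟨hBi, hBi₀⟩ := hB i (Finset.mem_insert_self i s)
    obtain ⟨k, hk, hk'⟩ := (isWeaklyMixing_iff.1 h (A i) U (B i) V hAi hAi₀ hU hU₀
      hBi hBi₀ hV hV₀).nonempty
    refine ⟨_, _, hAi.inter (hU.preimage (hT.iterate k)), hk,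
      hBi.inter (hV.preimage (hT.iterate k)), hk', ?_⟩
    rw [Finset.set_biInter_insert]
    exact (visitTimes_inter_preimage_subset ..).trans (Set.inter_subset_inter_right _ hUV)

/-- A variant of Petersen's criterion for weak mixing. -/
theorem isWeaklyMixing_of_inter_visitTimes (hT : Continuous T) (hTs : Surjective T)
    (h : ∀ U V V' : Set α, IsOpen U → U.Nonempty → IsOpen V → V.Nonempty → IsOpen V' →
      V'.Nonempty → (visitTimes T U V ∩ visitTimes T U V').Infinite) :
    IsWeaklyMixing T := by
  refine isWeaklyMixing_iff.2 fun U V U' V' hU hU₀ hV hV₀ hU' hU₀' hV' hV₀' => ?_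
  obtain ⟨k, hk, -⟩ := (h U U' U' hU hU₀ hU' hU₀' hU' hU₀').nonempty
  refine (h (U ∩ T^[k] ⁻¹' U') V (T^[k] ⁻¹' V') (hU.inter (hU'.preimage (hT.iterate k))) hk hV hV₀
    (hV'.preimage (hT.iterate k)) (hV₀'.preimage (hTs.iterate k))).mono ?_
  rintro n ⟨hn, hn'⟩
  refine ⟨visitTimes_mono Set.inter_subset_left subset_rfl hn,
    (visitTimes_inter_preimage_subset T U univ U' V' k ?_).2⟩
  rwa [Set.univ_inter]

end Topological

section Measures

theorem isOpen_setOf_lt_measure {X : Type*} [TopologicalSpace X] [HasOuterApproxClosed X]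
    [MeasurableSpace X] [OpensMeasurableSpace X] {U : Set X} (hU : IsOpen U) (c : ENNReal) :
    IsOpen {μ : ProbabilityMeasure X | c < (μ : Measure X) U} := by
  refine isOpen_iff_mem_nhds.2 fun μ hμ => ?_
  exact Filter.eventually_lt_of_lt_liminf (lt_of_lt_of_le hμ
    (ProbabilityMeasure.le_liminf_measure_open_of_tendsto Filter.tendsto_id hU))

theorem levyProkhorovEDist_map_le {Ω X : Type*} [MeasurableSpace Ω] [PseudoEMetricSpace X]
    [MeasurableSpace X] [OpensMeasurableSpace X] (P : Measure Ω) {f g : Ω → X} (hf : Measurable f)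
    (hg : Measurable g) {δ : ENNReal} (h : ∀ ω, edist (f ω) (g ω) ≤ δ) :
    levyProkhorovEDist (P.map f) (P.map g) ≤ δ := by
  have key : ∀ {f g : Ω → X}, Measurable f → Measurable g → (∀ ω, edist (f ω) (g ω) ≤ δ) →
      ∀ (ε : ENNReal) (B : Set X), δ < ε → ε < ⊤ → MeasurableSet B →
        P.map f B ≤ P.map g (Metric.thickening ε.toReal B) + ε := by
    intro f g hf hg h ε B hδ hε hB
    rw [Measure.map_apply hf hB, Measure.map_apply hg Metric.isOpen_thickening.measurableSet]
    refine le_add_right (measure_mono fun ω hω => ?_)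
    rw [Set.mem_preimage, Metric.mem_thickening_iff_exists_edist_lt, ENNReal.ofReal_toReal hε.ne]
    exact ⟨f ω, hω, by rw [edist_comm]; exact (h ω).trans_lt hδ⟩
  exact levyProkhorovEDist_le_of_forall _ _ _ fun ε B hδ hε hB =>
    ⟨key hf hg h ε B hδ hε hB, key hg hf (fun ω => by rw [edist_comm]; exact h ω) ε B hδ hε hB⟩

/-- An open set of probability measures is stable under uniformly small perturbations of the
random variables representing a given element. -/
theorem exists_forall_map_mem {X : Type*} [PseudoMetricSpace X] [SeparableSpace X]
    [MeasurableSpace X] [BorelSpace X] {𝒰 : Set (ProbabilityMeasure X)} (h𝒰 : IsOpen 𝒰)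
    {μ : ProbabilityMeasure X} (hμ : μ ∈ 𝒰) :
    ∃ r : ℝ, 0 < r ∧ ∀ {Ω : Type*} [MeasurableSpace Ω] (P : ProbabilityMeasure Ω) (f g : Ω → X)
      (hf : Measurable f) (hg : Measurable g), P.map hf.aemeasurable = μ →
      (∀ ω, dist (f ω) (g ω) ≤ r) → P.map hg.aemeasurable ∈ 𝒰 := by
  have hnhds := (LevyProkhorov.continuous_toMeasure_probabilityMeasure (Ω := X)).isOpen_preimage
    𝒰 h𝒰
  obtain ⟨ε, hε, hball⟩ := EMetric.isOpen_iff.1 hnhds (LevyProkhorov.ofMeasure μ) hμ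
  obtain ⟨r, hr, hrε⟩ := ENNReal.lt_iff_exists_nnreal_btwn.1 hε
  refine ⟨r, by exact_mod_cast hr, fun {Ω} _ P f g hf hg hP hfg => ?_⟩
  refine @hball (LevyProkhorov.ofMeasure (P.map hg.aemeasurable)) ?_
  rw [Metric.mem_eball, LevyProkhorov.edist_probabilityMeasure_def, levyProkhorovEDist_comm]
  refine lt_of_le_of_lt ?_ hrε
  rw [← hP]
  exact levyProkhorovEDist_map_le _ hf hg fun ω => by
    rw [edist_dist]
    exact ENNReal.ofReal_le_of_le_toReal (hfg ω)

theorem exists_simpleFunc_dist_lt {X : Type*} [PseudoMetricSpace X] [CompactSpace X] [Nonempty X]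
    [MeasurableSpace X] [OpensMeasurableSpace X] {r : ℝ} (hr : 0 < r) :
    ∃ φ : SimpleFunc X X, ∀ x, dist (φ x) x < r := by
  obtain ⟨t, ht⟩ := isCompact_univ.elim_finite_subcover
    (fun n => Metric.ball (denseSeq X n) r) (fun _ => Metric.isOpen_ball) fun x _ => by
      obtain ⟨_, hn, n, rfl⟩ := Metric.dense_iff.1 (denseRange_denseSeq X) x r hr
      exact Set.mem_iUnion.2 ⟨n, by rwa [Metric.mem_ball_comm]⟩
  refine ⟨SimpleFunc.nearestPt (denseSeq X) (t.sup id), fun x => ?_⟩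
  obtain ⟨n, hn, hx⟩ := Set.mem_iUnion₂.1 (ht (Set.mem_univ x))
  have h := SimpleFunc.edist_nearestPt_le (denseSeq X) x (Finset.le_sup (f := id) hn)
  rw [edist_dist, edist_dist, ENNReal.ofReal_le_ofReal_iff dist_nonneg] at h
  rw [Metric.mem_ball, dist_comm] at hx
  exact h.trans_lt hx

theorem TM_iterate {X : Type*} [TopologicalSpace X] [MeasurableSpace X] [BorelSpace X] {T : X → X}
    (hT : Continuous T) (n : ℕ) (μ : ProbabilityMeasure X) :
    (TM T hT)^[n] μ = μ.map (hT.iterate n).measurable.aemeasurable := by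
  induction n with
  | zero => exact Subtype.ext Measure.map_id.symm
  | succ n ih =>
    rw [Function.iterate_succ_apply', ih]
    refine Subtype.ext ((Measure.map_map hT.measurable (hT.iterate n).measurable).trans ?_)
    rw [← Function.iterate_succ']
    rfl

theorem IsTransitive.isWeaklyMixing_of_TM {X : Type*} [TopologicalSpace X] [HasOuterApproxClosed X]
    [MeasurableSpace X] [BorelSpace X] {T : X → X} (hT : Continuous T) (hTs : Surjective T)
    (h : IsTransitive (TM T hT)) : IsWeaklyMixing T := by
  refine isWeaklyMixing_of_inter_visitTimes hT hTs ?_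
  rintro U V V' hU ⟨u, hu⟩ hV ⟨v, hv⟩ hV' ⟨v', hv'⟩
  let 𝒰 : Set (ProbabilityMeasure X) := {μ | 2 / 3 < (μ : Measure X) U}
  let 𝒱 : Set (ProbabilityMeasure X) :=
    {μ | 1 / 3 < (μ : Measure X) V} ∩ {μ | 1 / 3 < (μ : Measure X) V'}
  have h𝒰 : 𝒰.Nonempty := by
    refine ⟨⟨Measure.dirac u, inferInstance⟩, ?_⟩
    change 2 / 3 < Measure.dirac u U
    rw [Measure.dirac_apply_of_mem hu]
    exact ENNReal.div_lt_of_lt_mul (by norm_num)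
  have h𝒱 : 𝒱.Nonempty := by
    have hlt : (1 / 3 : ENNReal) < 2⁻¹ := by
      rw [one_div]
      exact ENNReal.inv_lt_inv.2 (by norm_num)
    refine ⟨⟨(2⁻¹ : ENNReal) • Measure.dirac v + (2⁻¹ : ENNReal) • Measure.dirac v', ⟨?_⟩⟩, ?_, ?_⟩
    · simp [ENNReal.inv_two_add_inv_two]
    · refine hlt.trans_le ?_
      simp [Measure.dirac_apply_of_mem hv]
    · refine hlt.trans_le ?_
      simp [Measure.dirac_apply_of_mem hv']
  refine (h 𝒰 𝒱 (isOpen_setOf_lt_measure hU _) h𝒰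
    ((isOpen_setOf_lt_measure hV _).inter (isOpen_setOf_lt_measure hV' _)) h𝒱).mono ?_
  rintro n ⟨μ, hμU, hμV, hμV'⟩
  rw [TM_iterate] at hμV hμV'
  have key : ∀ {W : Set X}, IsOpen W →
      1 / 3 < (μ.map (hT.iterate n).measurable.aemeasurable : Measure X) W →
      n ∈ visitTimes T U W := by
    intro W hW hμW
    rw [ProbabilityMeasure.toMeasure_map, Measure.map_apply (hT.iterate n).measurable
      hW.measurableSet] at hμW
    refine nonempty_inter_of_measure_lt_add (μ : Measure X)
      (hW.preimage (hT.iterate n)).measurableSet (Set.subset_univ _) (Set.subset_univ _) ?_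
    rw [measure_univ]
    refine lt_of_eq_of_lt ?_ (ENNReal.add_lt_add hμU hμW)
    rw [ENNReal.div_add_div_same, show (2 + 1 : ENNReal) = 3 by norm_num,
      ENNReal.div_self (by norm_num) (by norm_num)]
  exact ⟨key hV hμV, key hV' hμV'⟩

theorem IsWeaklyMixing.exists_visitTimes_subset_TM {X : Type*} [PseudoMetricSpace X]
    [CompactSpace X] [MeasurableSpace X] [BorelSpace X] {T : X → X} (hT : Continuous T)
    (h : IsWeaklyMixing T) {𝒰 𝒱 : Set (ProbabilityMeasure X)} (h𝒰 : IsOpen 𝒰) (h𝒰₀ : 𝒰.Nonempty)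
    (h𝒱 : IsOpen 𝒱) (h𝒱₀ : 𝒱.Nonempty) :
    ∃ U V : Set X, IsOpen U ∧ U.Nonempty ∧ IsOpen V ∧ V.Nonempty ∧
      visitTimes T U V ⊆ visitTimes (TM T hT) 𝒰 𝒱 := by
  obtain ⟨μ, hμ⟩ := h𝒰₀
  obtain ⟨ν, hν⟩ := h𝒱₀
  have : Nonempty X := (μ : Measure X).nonempty_of_neZero
  obtain ⟨r₁, hr₁, hμr⟩ := exists_forall_map_mem h𝒰 hμ
  obtain ⟨r₂, hr₂, hνr⟩ := exists_forall_map_mem h𝒱 hν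
  obtain ⟨r, hr, hrr⟩ : ∃ r, 0 < r ∧ r + r ≤ min r₁ r₂ :=
    ⟨min r₁ r₂ / 2, half_pos (lt_min hr₁ hr₂), (add_halves _).le⟩
  obtain ⟨φ, hφ⟩ := exists_simpleFunc_dist_lt (X := X) hr
  have hball : ∀ x : X, IsOpen (Metric.ball x r) ∧ (Metric.ball x r).Nonempty := fun x =>
    ⟨Metric.isOpen_ball, Metric.nonempty_ball.2 hr⟩
  obtain ⟨U, V, hU, hU₀, hV, hV₀, hUV⟩ := h.exists_visitTimes_subset_iInter hT
    (φ.range ×ˢ φ.range) (fun p => Metric.ball p.1 r) (fun p => Metric.ball p.2 r)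
    (fun p _ => hball p.1) (fun p _ => hball p.2)
  refine ⟨U, V, hU, hU₀, hV, hV₀, fun n hn => ?_⟩
  have hvisit : ∀ p : X × X, ∃ y, p ∈ φ.range ×ˢ φ.range →
      dist y p.1 < r ∧ dist (T^[n] y) p.2 < r := by
    intro p
    by_cases hp : p ∈ φ.range ×ˢ φ.range
    · obtain ⟨y, hy, hy'⟩ := Set.mem_iInter₂.1 (hUV hn) p hp
      exact ⟨y, fun _ => ⟨hy, hy'⟩⟩
    · exact ⟨p.1, fun hp' => absurd hp' hp⟩
  choose y hy using hvisit
  let g : SimpleFunc (X × X) X :=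
    ((φ.comp Prod.fst measurable_fst).pair (φ.comp Prod.snd measurable_snd)).map y
  have hg : ∀ p : X × X, dist (g p) (φ p.1) < r ∧ dist (T^[n] (g p)) (φ p.2) < r := fun p =>
    hy (φ p.1, φ p.2) (Finset.mk_mem_product (φ.mem_range_self _) (φ.mem_range_self _))
  let P : ProbabilityMeasure (X × X) := μ.prod ν
  refine ⟨P.map g.measurable.aemeasurable, ?_, ?_⟩
  · refine hμr P Prod.fst g measurable_fst g.measurable ?_ fun p => ?_
    · exact Subtype.ext (by simp [P])
    · have h₁ := (hg p).1
      have h₂ := hφ p.1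
      have h₃ := dist_triangle_left p.1 (g p) (φ p.1)
      rw [dist_comm] at h₁
      linarith [min_le_left r₁ r₂]
  · have hTg : Measurable fun p => T^[n] (g p) := (hT.iterate n).measurable.comp g.measurable
    have hmap : (TM T hT)^[n] (P.map g.measurable.aemeasurable) = P.map hTg.aemeasurable := by
      rw [TM_iterate]
      exact Subtype.ext (Measure.map_map (hT.iterate n).measurable g.measurable)
    rw [Set.mem_preimage, hmap]
    refine hνr P Prod.snd _ measurable_snd hTg ?_ fun p => ?_
    · exact Subtype.ext (by simp [P])
    · have h₁ := (hg p).2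
      have h₂ := hφ p.2
      have h₃ := dist_triangle_left p.2 (T^[n] (g p)) (φ p.2)
      rw [dist_comm] at h₁
      linarith [min_le_right r₁ r₂]

theorem IsWeaklyMixing.isWeaklyMixing_TM {X : Type*} [PseudoMetricSpace X] [CompactSpace X]
    [MeasurableSpace X] [BorelSpace X] {T : X → X} (hT : Continuous T) (h : IsWeaklyMixing T) :
    IsWeaklyMixing (TM T hT) := by
  refine isWeaklyMixing_iff.2 fun 𝒰 𝒱 𝒰' 𝒱' h𝒰 h𝒰₀ h𝒱 h𝒱₀ h𝒰' h𝒰₀' h𝒱' h𝒱₀' => ?_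
  obtain ⟨U, V, hU, hU₀, hV, hV₀, hUV⟩ := h.exists_visitTimes_subset_TM hT h𝒰 h𝒰₀ h𝒱 h𝒱₀
  obtain ⟨U', V', hU', hU₀', hV', hV₀', hUV'⟩ :=
    h.exists_visitTimes_subset_TM hT h𝒰' h𝒰₀' h𝒱' h𝒱₀'
  exact (isWeaklyMixing_iff.1 h U V U' V' hU hU₀ hV hV₀ hU' hU₀' hV' hV₀').mono
    (Set.inter_subset_inter hUV hUV')

end Measures

theorem weakly_mixing_iff_measures_transitive {X : Type*}
    [MetricSpace X] [CompactSpace X] [MeasurableSpace X] [BorelSpace X]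
    (T : X → X) (hT : Continuous T) (hTs : Surjective T) :
    (IsWeaklyMixing T ↔ IsTransitive (TM T hT)) ∧
    (IsTransitive (TM T hT) ↔ IsWeaklyMixing (TM T hT)) := by
  have hTM : IsTransitive (TM T hT) → IsWeaklyMixing T := IsTransitive.isWeaklyMixing_of_TM hT hTs
  exact ⟨⟨fun h => (h.isWeaklyMixing_TM hT).isTransitive, hTM⟩,
    fun h => (hTM h).isWeaklyMixing_TM hT, fun h => h.isTransitive⟩

end Paper
end
end

section
/- The following are equivalent for a t.d.s. (X,T): (1) (X,T) is an almost HY-system (totally transitive with almost dense periodic sets); (2) (X,T) is weakly mixing and for each non-empty open U ⊂ X and ε > 0 there are k ∈ ℕ and an ergodic T^k-invariant measure μ with μ(X\U) < ε; (3) the induced system (M(X), T_M) is a P-system (transitive with dense periodic points); (4) (M(X), T_M) is an almost HY-system. -/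
open MeasureTheory Topology Set Function TopologicalSpace

noncomputable section

namespace Paper

section Topological

variable {α : Type*} [TopologicalSpace α] {T : α → α}

theorem IsWeaklyMixing.infinite_inter (h : IsWeaklyMixing T) {U₁ V₁ U₂ V₂ : Set α}
    (hU₁ : IsOpen U₁) (hU₁' : U₁.Nonempty) (hV₁ : IsOpen V₁) (hV₁' : V₁.Nonempty)
    (hU₂ : IsOpen U₂) (hU₂' : U₂.Nonempty) (hV₂ : IsOpen V₂) (hV₂' : V₂.Nonempty) :
    {n : ℕ | (U₁ ∩ T^[n] ⁻¹' V₁).Nonempty ∧ (U₂ ∩ T^[n] ⁻¹' V₂).Nonempty}.Infinite := by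
  refine (h (U₁ ×ˢ U₂) (V₁ ×ˢ V₂) (hU₁.prod hU₂) (hU₁'.prod hU₂') (hV₁.prod hV₂)
    (hV₁'.prod hV₂')).mono ?_
  rintro n ⟨⟨x, y⟩, ⟨hx, hy⟩, hxy⟩
  rw [Prod.map_iterate] at hxy
  exact ⟨⟨x, hx, hxy.1⟩, ⟨y, hy, hxy.2⟩⟩

theorem isWeaklyMixing_of_infinite_inter
    (h : ∀ U₁ V₁ U₂ V₂ : Set α, IsOpen U₁ → U₁.Nonempty → IsOpen V₁ → V₁.Nonempty →
      IsOpen U₂ → U₂.Nonempty → IsOpen V₂ → V₂.Nonempty →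
      {n : ℕ | (U₁ ∩ T^[n] ⁻¹' V₁).Nonempty ∧ (U₂ ∩ T^[n] ⁻¹' V₂).Nonempty}.Infinite) :
    IsWeaklyMixing T := by
  rintro U V hU ⟨⟨x, y⟩, hxy⟩ hV ⟨⟨z, w⟩, hzw⟩
  obtain ⟨U₁, U₂, hU₁, hU₂, hx, hy, hUU⟩ := isOpen_prod_iff.1 hU x y hxy
  obtain ⟨V₁, V₂, hV₁, hV₂, hz, hw, hVV⟩ := isOpen_prod_iff.1 hV z w hzw
  refine (h U₁ V₁ U₂ V₂ hU₁ ⟨x, hx⟩ hV₁ ⟨z, hz⟩ hU₂ ⟨y, hy⟩ hV₂ ⟨w, hw⟩).mono ?_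
  rintro n ⟨⟨a, ha, ha'⟩, ⟨b, hb, hb'⟩⟩
  refine ⟨(a, b), hUU ⟨ha, hb⟩, ?_⟩
  rw [Prod.map_iterate]
  exact hVV ⟨ha', hb'⟩

/-- To check weak mixing of a surjective transitive map it suffices to consider two pairs with
a common first set. -/
theorem IsTransitive.isWeaklyMixing (hT : Continuous T) (hTs : Surjective T) (ht : IsTransitive T)
    (h : ∀ U V₁ V₂ : Set α, IsOpen U → U.Nonempty → IsOpen V₁ → V₁.Nonempty →
      IsOpen V₂ → V₂.Nonempty →
      {n : ℕ | (U ∩ T^[n] ⁻¹' V₁).Nonempty ∧ (U ∩ T^[n] ⁻¹' V₂).Nonempty}.Infinite) :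
    IsWeaklyMixing T := by
  refine isWeaklyMixing_of_infinite_inter ?_
  intro U₁ V₁ U₂ V₂ hU₁ hU₁' hV₁ hV₁' hU₂ hU₂' hV₂ hV₂'
  obtain ⟨a, ha⟩ := (ht U₁ U₂ hU₁ hU₁' hU₂ hU₂').nonempty
  refine (h (U₁ ∩ T^[a] ⁻¹' U₂) V₁ (T^[a] ⁻¹' V₂) (hU₁.inter (hU₂.preimage (hT.iterate a))) ha
    hV₁ hV₁' (hV₂.preimage (hT.iterate a)) (hV₂'.preimage (hTs.iterate a))).mono ?_
  rintro n ⟨⟨x, hx, hx'⟩, ⟨y, hy, hy'⟩⟩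
  refine ⟨⟨x, hx.1, hx'⟩, ⟨T^[a] y, hy.2, ?_⟩⟩
  rw [mem_preimage, ← iterate_add_apply, add_comm, iterate_add_apply]
  exact hy'

/-- Furstenberg's intersection lemma: hitting time sets of a weakly mixing map form a filter
base. -/
theorem IsWeaklyMixing.exists_forall_mem [Nonempty α] (hT : Continuous T) (h : IsWeaklyMixing T)
    {ι : Type*} (s : Finset ι) {U V : ι → Set α} (hU : ∀ i, IsOpen (U i))
    (hU' : ∀ i, (U i).Nonempty) (hV : ∀ i, IsOpen (V i)) (hV' : ∀ i, (V i).Nonempty) :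
    ∃ A B : Set α, IsOpen A ∧ A.Nonempty ∧ IsOpen B ∧ B.Nonempty ∧
      ∀ n, (A ∩ T^[n] ⁻¹' B).Nonempty → ∀ i ∈ s, (U i ∩ T^[n] ⁻¹' V i).Nonempty := by
  classical
  induction s using Finset.induction_on with
  | empty => exact ⟨univ, univ, isOpen_univ, univ_nonempty, isOpen_univ, univ_nonempty, by simp⟩
  | insert i s _ ih =>
    obtain ⟨A, B, hA, hA', hB, hB', hAB⟩ := ih
    obtain ⟨n, hn₁, hn₂⟩ :=
      (h.infinite_inter hA hA' (hU i) (hU' i) hB hB' (hV i) (hV' i)).nonempty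
    refine ⟨A ∩ T^[n] ⁻¹' U i, B ∩ T^[n] ⁻¹' V i, hA.inter ((hU i).preimage (hT.iterate n)), hn₁,
      hB.inter ((hV i).preimage (hT.iterate n)), hn₂, ?_⟩
    rintro m ⟨x, ⟨hxA, hxU⟩, hxB, hxV⟩ j hj
    rcases Finset.mem_insert.1 hj with rfl | hj
    · refine ⟨T^[n] x, hxU, ?_⟩
      rw [mem_preimage, ← iterate_add_apply, add_comm, iterate_add_apply]
      exact hxV
    · exact hAB m ⟨x, hxA, hxB⟩ j hj

theorem IsWeaklyMixing.isTotallyTransitive (hT : Continuous T) (hTs : Surjective T)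
    (h : IsWeaklyMixing T) : IsTotallyTransitive T := by
  intro k hk U V hU hU' hV hV'
  have : Nonempty α := ⟨hU'.some⟩
  obtain ⟨A, B, hA, hA', hB, hB', hAB⟩ := h.exists_forall_mem hT (Finset.range (k + 1))
    (U := fun _ => U) (V := fun i => T^[i] ⁻¹' V) (fun _ => hU) (fun _ => hU')
    (fun i => hV.preimage (hT.iterate i)) (fun i => hV'.preimage (hTs.iterate i))
  have hinf := h.isTransitive A B hA hA' hB hB'
  rw [Set.infinite_iff_exists_gt] at hinf ⊢
  intro a
  obtain ⟨m, hm, ham⟩ := hinf (k * (a + 1))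
  obtain ⟨i, hi, j, hij⟩ : ∃ i < k + 1, ∃ j, i + m = k * j := by
    have h₁ := Nat.div_add_mod m k
    have h₂ := Nat.mod_lt m hk
    exact ⟨k - m % k, by omega, m / k + 1, by rw [mul_add]; omega⟩
  obtain ⟨x, hx, hx'⟩ := hAB m hm i (Finset.mem_range.2 hi)
  refine ⟨j, ⟨x, hx, ?_⟩, ?_⟩
  · rw [mem_preimage, ← iterate_mul, ← hij, iterate_add_apply]
    exact hx'
  · have : k * (a + 1) < k * j := by omega
    have := Nat.lt_of_mul_lt_mul_left this
    omega

end Topological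

/-- A continuous self-map has dense periodic points only if it has almost dense periodic sets. -/
theorem AlmostDensePeriodicSets.of_dense_isPeriodicPoint {α : Type*} [TopologicalSpace α]
    {S : α → α} (hS : Continuous S) (hd : Dense {x | IsPeriodicPoint S x}) :
    AlmostDensePeriodicSets S := by
  borelize α
  intro U hU hU' ε hε
  obtain ⟨x, hxU, k, hk, hkx⟩ := hd.inter_open_nonempty U hU hU'
  refine ⟨k, hk, Measure.dirac x, inferInstance, ?_, ?_⟩
  · rw [Measure.map_dirac' (hS.iterate k).measurable, hkx]
  · rw [Measure.dirac_apply' x hU.measurableSet.compl]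
    simp [hxU, hε]

theorem le_of_convexComb_le {a b p q r : ℝ} (ha : 0 < a) (hb : 0 ≤ b) (hab : a + b = 1)
    (hq : r ≤ q) (h : a * p + b * q ≤ r) : p ≤ r := by
  refine le_of_mul_le_mul_left ?_ ha
  have hbq : b * r ≤ b * q := mul_le_mul_of_nonneg_left hq hb
  have hr : a * r + b * r = r := by rw [← add_mul, hab, one_mul]
  linarith

section Measures

variable {X : Type*} [MetricSpace X] [MeasurableSpace X] [BorelSpace X]

theorem isOpen_setOf_measure_lt {F : Set X} (hF : IsClosed F) (c : ENNReal) :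
    IsOpen {μ : ProbabilityMeasure X | (μ : Measure X) F < c} := by
  refine isOpen_iff_mem_nhds.2 fun μ hμ => ?_
  have h := ProbabilityMeasure.limsup_measure_closed_le_of_tendsto
    (Filter.tendsto_id (α := ProbabilityMeasure X) (x := 𝓝 μ)) hF
  exact Filter.eventually_lt_of_limsup_lt (lt_of_le_of_lt h hμ)

theorem measurable_toMeasure_borel :
    @Measurable (ProbabilityMeasure X) (Measure X) (borel _) _ ProbabilityMeasure.toMeasure := by
  borelize (ProbabilityMeasure X)
  refine Measurable.measure_of_isPiSystem_of_isProbabilityMeasure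
    ((BorelSpace.measurable_eq (α := X)).trans borel_eq_generateFrom_isClosed)
    isPiSystem_isClosed fun F hF => ?_
  exact measurable_of_Iio fun c => (isOpen_setOf_measure_lt hF c).measurableSet

/-- The functional on continuous functions defined by a probability measure. -/
def integralFunctional (μ : ProbabilityMeasure X) (f : C(X, ℝ)) : ℝ := ∫ x, f x ∂(μ : Measure X)

theorem injective_integralFunctional :
    Injective (integralFunctional : ProbabilityMeasure X → C(X, ℝ) → ℝ) := by
  intro μ ν h
  refine ProbabilityMeasure.toMeasure_injective
    (ext_of_forall_integral_eq_of_IsFiniteMeasure fun f => ?_)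
  exact congrFun h f.toContinuousMap

/-- The arithmetic mean of a finite family of probability measures. -/
def uniformAverage {n : ℕ} (ν : Fin (n + 1) → ProbabilityMeasure X) : ProbabilityMeasure X :=
  ⟨((n + 1 : ℕ) : ENNReal)⁻¹ • ∑ i, (ν i : Measure X), ⟨by
    simp only [Measure.smul_apply, Measure.coe_finsetSum, Finset.sum_apply, measure_univ,
      Finset.sum_const, Finset.card_univ, Fintype.card_fin, nsmul_eq_mul, mul_one, smul_eq_mul]
    exact ENNReal.inv_mul_cancel (by simp) (by simp)⟩⟩

omit [MetricSpace X] [BorelSpace X] in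
theorem uniformAverage_apply {n : ℕ} (ν : Fin (n + 1) → ProbabilityMeasure X) (s : Set X) :
    (uniformAverage ν : Measure X) s = ((n + 1 : ℕ) : ENNReal)⁻¹ * ∑ i, (ν i : Measure X) s := by
  simp [uniformAverage]

variable {T : X → X} (hT : Continuous T)

theorem continuous_TM : Continuous (TM T hT) :=
  ProbabilityMeasure.continuous_map hT

theorem toMeasure_iterate_TM (k : ℕ) (μ : ProbabilityMeasure X) :
    ((TM T hT)^[k] μ : Measure X) = (μ : Measure X).map T^[k] := by
  induction k generalizing μ with
  | zero => simp
  | succ k ih =>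
    rw [iterate_succ_apply, ih, iterate_succ,
      ← Measure.map_map (hT.iterate k).measurable hT.measurable]
    rfl

theorem iterate_TM_uniformAverage (k : ℕ) {n : ℕ} (ν : Fin (n + 1) → ProbabilityMeasure X) :
    (TM T hT)^[k] (uniformAverage ν) = uniformAverage fun i => (TM T hT)^[k] (ν i) := by
  refine ProbabilityMeasure.toMeasure_injective (Measure.ext fun s hs => ?_)
  have hk := (hT.iterate k).measurable
  simp only [toMeasure_iterate_TM, uniformAverage_apply, Measure.map_apply hk hs]

theorem iterate_TM_diracProba (k : ℕ) (x : X) :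
    (TM T hT)^[k] (diracProba x) = diracProba (T^[k] x) := by
  refine ProbabilityMeasure.toMeasure_injective ?_
  rw [toMeasure_iterate_TM]
  exact Measure.map_dirac' (hT.iterate k).measurable x

theorem isPeriodicPoint_TM_iff (μ : ProbabilityMeasure X) :
    IsPeriodicPoint (TM T hT) μ ↔ ∃ k : ℕ, 0 < k ∧ (μ : Measure X).map T^[k] = μ := by
  simp only [IsPeriodicPoint, ← toMeasure_iterate_TM hT,
    ProbabilityMeasure.toMeasure_injective.eq_iff]

theorem isWeaklyMixing_of_isTransitive_TM (hTs : Surjective T) (h : IsTransitive (TM T hT)) :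
    IsWeaklyMixing T := by
  have key : ∀ U V₁ V₂ : Set X, IsOpen U → U.Nonempty → IsOpen V₁ → V₁.Nonempty →
      IsOpen V₂ → V₂.Nonempty →
      {n : ℕ | (U ∩ T^[n] ⁻¹' V₁).Nonempty ∧ (U ∩ T^[n] ⁻¹' V₂).Nonempty}.Infinite := by
    intro U V₁ V₂ hU ⟨x, hx⟩ hV₁ ⟨y, hy⟩ hV₂ ⟨z, hz⟩
    have h3 : (1 / 3 : ENNReal) + 2 / 3 = 1 := by
      rw [ENNReal.div_add_div_same, show (1 + 2 : ENNReal) = 3 by norm_num]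
      exact ENNReal.div_self (by simp) (by simp)
    have h12 : (2 : ENNReal)⁻¹ < 2 / 3 := by
      rw [← ENNReal.toReal_lt_toReal (by simp) (ENNReal.div_ne_top (by simp) (by simp))]
      norm_num
    have havg : ∀ (μ ν : ProbabilityMeasure X) (s : Set X),
        (μ : Measure X) s + (ν : Measure X) s ≤ 1 →
        (uniformAverage ![μ, ν] : Measure X) s < 2 / 3 := by
      intro μ ν s hs
      refine lt_of_le_of_lt ?_ h12
      rw [uniformAverage_apply, Fin.sum_univ_two]
      exact mul_le_of_le_one_right' hs
    refine (h {μ | (μ : Measure X) Uᶜ < 1 / 3}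
      ({μ | (μ : Measure X) V₁ᶜ < 2 / 3} ∩ {μ | (μ : Measure X) V₂ᶜ < 2 / 3})
      (isOpen_setOf_measure_lt hU.isClosed_compl _) ⟨diracProba x, ?_⟩
      ((isOpen_setOf_measure_lt hV₁.isClosed_compl _).inter
        (isOpen_setOf_measure_lt hV₂.isClosed_compl _))
      ⟨uniformAverage ![diracProba y, diracProba z], ?_, ?_⟩).mono ?_
    · simp [hx]
    · refine havg _ _ _ ?_
      rw [show (diracProba y : Measure X) V₁ᶜ = 0 by simp [hy], zero_add]
      exact prob_le_one
    · refine havg _ _ _ ?_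
      rw [show (diracProba z : Measure X) V₂ᶜ = 0 by simp [hz], add_zero]
      exact prob_le_one
    · rintro n ⟨μ, hμU, hμ₁, hμ₂⟩
      have aux : ∀ V : Set X, IsOpen V → ((TM T hT)^[n] μ : Measure X) Vᶜ < 2 / 3 →
          (U ∩ T^[n] ⁻¹' V).Nonempty := by
        intro V hV hμV
        rw [toMeasure_iterate_TM, Measure.map_apply (hT.iterate n).measurable
          hV.measurableSet.compl] at hμV
        by_contra hne
        have h1 : (μ : Measure X) (Uᶜ ∪ T^[n] ⁻¹' Vᶜ) < 1 :=
          (measure_union_le _ _).trans_lt (h3 ▸ ENNReal.add_lt_add hμU hμV)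
        rw [preimage_compl, ← compl_inter, not_nonempty_iff_eq_empty.1 hne, compl_empty,
          measure_univ] at h1
        exact h1.false
      exact ⟨aux V₁ hV₁ hμ₁, aux V₂ hV₂ hμ₂⟩
  refine IsTransitive.isWeaklyMixing hT hTs ?_ key
  intro U V hU hU' hV hV'
  exact (key U V V hU hU' hV hV' hV hV').mono fun n hn => hn.1

theorem almostDensePeriodicSets_iff : AlmostDensePeriodicSets T ↔
    ∀ U : Set X, IsOpen U → U.Nonempty → ∀ ε : ℝ, 0 < ε → ∃ k : ℕ, 0 < k ∧ ∃ μ : Measure X,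
      IsProbabilityMeasure μ ∧ μ.map T^[k] = μ ∧ μ Uᶜ < ENNReal.ofReal ε := by
  have h := BorelSpace.measurable_eq (α := X)
  subst h
  rfl

include hT in
theorem IsTotallyTransitive.isWeaklyMixing (hTs : Surjective T) (h : IsTotallyTransitive T)
    (hp : AlmostDensePeriodicSets T) : IsWeaklyMixing T := by
  rw [almostDensePeriodicSets_iff] at hp
  refine IsTransitive.isWeaklyMixing hT hTs (h 1 one_pos) ?_
  intro U V₁ V₂ hU hU' hV₁ hV₁' hV₂ hV₂'
  obtain ⟨b, hb⟩ := (h 1 one_pos U V₁ hU hU' hV₁ hV₁').nonempty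
  rw [iterate_one] at hb
  obtain ⟨k, hk, μ, _, hμ, hμW⟩ := hp _ (hU.inter (hV₁.preimage (hT.iterate b))) hb (1 / 2)
    (by norm_num)
  set W := U ∩ T^[b] ⁻¹' V₁
  have hWm : MeasurableSet W := (hU.inter (hV₁.preimage (hT.iterate b))).measurableSet
  have hret : ∀ j : ℕ, (W ∩ T^[k * j] ⁻¹' W).Nonempty := by
    intro j
    have hmp : MeasurePreserving T^[k * j] μ μ := by
      rw [iterate_mul]
      exact MeasurePreserving.iterate ⟨(hT.iterate k).measurable, hμ⟩ j
    by_contra hne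
    have h1 : μ (Wᶜ ∪ T^[k * j] ⁻¹' Wᶜ) < 1 := by
      refine (measure_union_le _ _).trans_lt ?_
      rw [hmp.measure_preimage hWm.compl.nullMeasurableSet]
      refine (ENNReal.add_lt_add hμW hμW).trans_eq ?_
      rw [← ENNReal.ofReal_add (by norm_num) (by norm_num)]
      norm_num
    rw [preimage_compl, ← compl_inter, not_nonempty_iff_eq_empty.1 hne, compl_empty,
      measure_univ] at h1
    exact h1.false
  have hinf := h k hk U (T^[b] ⁻¹' V₂) hU hU' (hV₂.preimage (hT.iterate b))
    (hV₂'.preimage (hTs.iterate b))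
  have hinj : Injective fun j => b + k * j := fun i j hij => by
    simpa [hk.ne'] using hij
  refine (hinf.image hinj.injOn).mono ?_
  rintro _ ⟨j, ⟨y, hyU, hyV⟩, rfl⟩
  obtain ⟨x, hx, hx'⟩ := hret j
  refine ⟨⟨x, hx.1, ?_⟩, ⟨y, hyU, ?_⟩⟩
  · rw [mem_preimage, iterate_add_apply]
    exact hx'.2
  · rw [mem_preimage, iterate_add_apply, iterate_mul]
    exact hyV

theorem diracProba_mem_closure_isPeriodicPoint (hp : AlmostDensePeriodicSets T) (x : X) :
    diracProba x ∈ closure {μ | IsPeriodicPoint (TM T hT) μ} := by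
  rw [almostDensePeriodicSets_iff] at hp
  choose k hk μ hμp hμ hμlt using fun n : ℕ => hp (Metric.ball x (1 / (n + 1))) Metric.isOpen_ball
    (Metric.nonempty_ball.2 Nat.one_div_pos_of_nat) (1 / (n + 1)) Nat.one_div_pos_of_nat
  refine mem_closure_of_tendsto (f := fun n => (⟨μ n, hμp n⟩ : ProbabilityMeasure X))
    (b := Filter.atTop) ?_ (Filter.Eventually.of_forall fun n => ?_)
  · refine tendsto_of_forall_isOpen_le_liminf' fun G hG => ?_
    by_cases hxG : x ∈ G
    · rw [diracProba_toMeasure_apply_of_mem hxG]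
      refine (Filter.Tendsto.liminf_eq ?_).ge
      obtain ⟨r, hr, hrG⟩ := Metric.isOpen_iff.1 hG x hxG
      have hlim : Filter.Tendsto (fun n : ℕ => 1 - ENNReal.ofReal (1 / ((n : ℝ) + 1)))
          Filter.atTop (𝓝 1) := by
        have := ENNReal.Tendsto.sub (tendsto_const_nhds (x := (1 : ENNReal)))
          (ENNReal.tendsto_ofReal tendsto_one_div_add_atTop_nhds_zero_nat) (Or.inl (by simp))
        simpa using this
      refine tendsto_of_tendsto_of_tendsto_of_le_of_le' hlim tendsto_const_nhds ?_
        (Filter.Eventually.of_forall fun n => prob_le_one (μ := μ n))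
      filter_upwards [tendsto_one_div_add_atTop_nhds_zero_nat.eventually (gt_mem_nhds hr)]
        with n hn
      have hsub : Gᶜ ⊆ (Metric.ball x (1 / ((n : ℝ) + 1)))ᶜ :=
        compl_subset_compl.2 ((Metric.ball_subset_ball hn.le).trans hrG)
      have h1 := prob_compl_eq_one_sub (μ := μ n) hG.measurableSet.compl
      rw [compl_compl] at h1
      change _ ≤ μ n G
      rw [h1]
      exact tsub_le_tsub_left ((measure_mono hsub).trans (hμlt n).le) 1
    · simp [hxG]
  · exact (isPeriodicPoint_TM_iff hT _).2 ⟨k n, hk n, hμ n⟩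

theorem almostDensePeriodicSets_of_dense (hd : Dense {μ | IsPeriodicPoint (TM T hT) μ}) :
    AlmostDensePeriodicSets T := by
  rw [almostDensePeriodicSets_iff]
  intro U hU ⟨x, hx⟩ ε hε
  obtain ⟨μ, hμU, hμ⟩ := hd.inter_open_nonempty _
    (isOpen_setOf_measure_lt hU.isClosed_compl (ENNReal.ofReal ε))
    ⟨diracProba x, by simp [hx, hε]⟩
  obtain ⟨k, hk, hkμ⟩ := (isPeriodicPoint_TM_iff hT μ).1 hμ
  exact ⟨k, hk, μ, inferInstance, hkμ, hμU⟩

/-- The barycentre of an invariant measure on the space of probability measures is invariant. -/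
theorem almostDensePeriodicSets_of_TM (hp : AlmostDensePeriodicSets (TM T hT)) :
    AlmostDensePeriodicSets T := by
  rw [almostDensePeriodicSets_iff]
  intro U hU ⟨x, hx⟩ ε hε
  let _ : MeasurableSpace (ProbabilityMeasure X) := borel _
  have : BorelSpace (ProbabilityMeasure X) := ⟨rfl⟩
  have hκ : Measurable (ProbabilityMeasure.toMeasure : ProbabilityMeasure X → Measure X) :=
    measurable_toMeasure_borel
  have hopen := isOpen_setOf_measure_lt hU.isClosed_compl (ENNReal.ofReal (ε / 2))
  obtain ⟨k, hk, Θ, _, hΘ, hΘU⟩ := hp _ hopen ⟨diracProba x, by simp [hx, hε]⟩ (ε / 2) (half_pos hε)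
  set 𝒰 := {μ : ProbabilityMeasure X | (μ : Measure X) Uᶜ < ENNReal.ofReal (ε / 2)}
  have hk' := (hT.iterate k).measurable
  refine ⟨k, hk, Θ.bind ProbabilityMeasure.toMeasure,
    isProbabilityMeasure_bind hκ.aemeasurable (Filter.Eventually.of_forall fun μ => inferInstance),
    Measure.ext fun s hs => ?_, ?_⟩
  · rw [Measure.map_apply hk' hs, Measure.bind_apply (hk' hs) hκ.aemeasurable,
      Measure.bind_apply hs hκ.aemeasurable]
    conv_rhs => rw [← hΘ]
    rw [lintegral_map (f := fun μ : ProbabilityMeasure X => (μ : Measure X) s)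
      ((Measure.measurable_coe hs).comp hκ) ((continuous_TM hT).iterate k).measurable]
    simp only [toMeasure_iterate_TM, Measure.map_apply hk' hs]
  · rw [Measure.bind_apply hU.measurableSet.compl hκ.aemeasurable]
    have hle : ∀ μ : ProbabilityMeasure X,
        (μ : Measure X) Uᶜ ≤ ENNReal.ofReal (ε / 2) + 𝒰ᶜ.indicator 1 μ := by
      intro μ
      by_cases hμ : μ ∈ 𝒰
      · exact le_add_right (le_of_lt hμ)
      · rw [indicator_of_mem (mem_compl hμ)]
        exact le_add_left prob_le_one
    calc ∫⁻ μ, (μ : Measure X) Uᶜ ∂Θ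
        ≤ ∫⁻ μ, (ENNReal.ofReal (ε / 2) + 𝒰ᶜ.indicator 1 μ) ∂Θ := lintegral_mono hle
      _ = ENNReal.ofReal (ε / 2) + Θ 𝒰ᶜ := by
        rw [lintegral_add_left measurable_const, lintegral_const, measure_univ, mul_one,
          lintegral_indicator_one hopen.measurableSet.compl]
      _ < ENNReal.ofReal (ε / 2) + ENNReal.ofReal (ε / 2) :=
        ENNReal.add_lt_add_left ENNReal.ofReal_ne_top hΘU
      _ = ENNReal.ofReal ε := by
        rw [← ENNReal.ofReal_add (half_pos hε).le (half_pos hε).le, add_halves]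

variable [CompactSpace X]

theorem continuous_integralFunctional :
    Continuous (integralFunctional : ProbabilityMeasure X → C(X, ℝ) → ℝ) :=
  continuous_pi fun f => ProbabilityMeasure.continuous_integral_continuousMap f

theorem isInducing_integralFunctional :
    IsInducing (integralFunctional : ProbabilityMeasure X → C(X, ℝ) → ℝ) :=
  (continuous_integralFunctional.isClosedEmbedding injective_integralFunctional).isInducing

theorem integral_uniformAverage {n : ℕ} (ν : Fin (n + 1) → ProbabilityMeasure X) (f : C(X, ℝ)) :
    ∫ x, f x ∂(uniformAverage ν : Measure X) =
      ((n + 1 : ℕ) : ℝ)⁻¹ * ∑ i, ∫ x, f x ∂(ν i : Measure X) := by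
  have hf : ∀ i ∈ Finset.univ, Integrable f (ν i : Measure X) := fun i _ =>
    (f.continuous.integrable_of_hasCompactSupport
      (HasCompactSupport.of_compactSpace f))
  simp only [uniformAverage, ProbabilityMeasure.coe_mk]
  rw [integral_smul_measure, integral_finsetSum_measure hf]
  rw [ENNReal.toReal_inv, ENNReal.toReal_natCast, smul_eq_mul]

theorem continuous_uniformAverage {n : ℕ} :
    Continuous (uniformAverage : (Fin (n + 1) → ProbabilityMeasure X) → ProbabilityMeasure X) := by
  rw [ProbabilityMeasure.continuous_iff_forall_continuousMap_continuous_integral]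
  intro f
  simp only [integral_uniformAverage]
  refine continuous_const.mul (continuous_finsetSum _ fun i _ => ?_)
  exact (ProbabilityMeasure.continuous_integral_continuousMap f).comp (continuous_apply i)

/-- Every open neighbourhood of a probability measure contains, for all large `n`, the uniform
measure on some `n + 1` points. -/
theorem eventually_exists_uniformAverage_mem {W : Set (ProbabilityMeasure X)} (hW : IsOpen W)
    (hW' : W.Nonempty) : ∀ᶠ n : ℕ in Filter.atTop,
      ∃ x : Fin (n + 1) → X, uniformAverage (fun i => diracProba (x i)) ∈ W := by
  obtain ⟨μ, hμ⟩ := hW'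
  obtain ⟨Ω, _, P, Y, hYm, hY, hind, hP⟩ :=
    ProbabilityTheory.exists_iid ℕ (μ : Measure X)
  obtain ⟨W', hW'o, rfl⟩ := isInducing_integralFunctional.isOpen_iff.1 hW
  obtain ⟨⟨I, t⟩, ⟨hI, ht⟩, htW⟩ :=
    ((nhds_pi (a := integralFunctional μ)).symm ▸
      Filter.hasBasis_pi fun f => nhds_basis_opens (integralFunctional μ f)).mem_iff.1
      (hW'o.mem_nhds hμ)
  have key : ∀ᵐ ω ∂P, ∀ f ∈ I, Filter.Tendsto
      (fun n : ℕ => (∑ i ∈ Finset.range n, f (Y i ω)) / n) Filter.atTop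
      (𝓝 (integralFunctional μ f)) := by
    rw [ae_ball_iff hI.countable]
    intro f _
    have hc : Measurable f := f.continuous.measurable
    have hid : ∀ i, ProbabilityTheory.IdentDistrib (fun ω => f (Y i ω)) (fun ω => f (Y 0 ω)) P P :=
      fun i => ((hY i).identDistrib (hY 0)).comp hc
    have hint : Integrable (fun ω => f (Y 0 ω)) P := by
      refine Integrable.of_bound (hc.comp (hYm 0)).aestronglyMeasurable ‖f‖ ?_
      exact Filter.Eventually.of_forall fun ω => f.norm_coe_le_norm _
    have hlim := ProbabilityTheory.strong_law_ae_real (fun i ω => f (Y i ω)) hint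
      (fun i j hij => (hind.indepFun hij).comp hc hc) hid
    rwa [show ∫ ω, f (Y 0 ω) ∂P = integralFunctional μ f from
      (hY 0).integral_comp hc.aestronglyMeasurable] at hlim
  obtain ⟨ω, hω⟩ := key.exists
  have : ∀ᶠ n : ℕ in Filter.atTop, ∀ f ∈ I,
      (∑ i ∈ Finset.range (n + 1), f (Y i ω)) / ((n + 1 : ℕ) : ℝ) ∈ t f := by
    rw [Filter.eventually_all_finite hI]
    intro f hf
    exact ((Filter.tendsto_add_atTop_iff_nat 1).2 (hω f hf)).eventually
      ((ht f hf).2.mem_nhds (ht f hf).1)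
  refine this.mono fun n hn => ⟨fun i => Y i ω, htW fun f hf => ?_⟩
  convert hn f hf using 1
  rw [integralFunctional, integral_uniformAverage, div_eq_inv_mul,
    Finset.sum_range (fun i => f (Y i ω))]
  simp [diracProba]

theorem IsWeaklyMixing.isTotallyTransitive_TM (hTs : Surjective T) (h : IsWeaklyMixing T) :
    IsTotallyTransitive (TM T hT) := by
  intro k hk U V hU hU' hV hV'
  have : Nonempty X := hU'.some.nonempty
  obtain ⟨n, ⟨x, hx⟩, ⟨y, hy⟩⟩ := ((eventually_exists_uniformAverage_mem hU hU').and
    (eventually_exists_uniformAverage_mem hV hV')).exists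
  have hc : Continuous fun z : Fin (n + 1) → X => uniformAverage fun i => diracProba (z i) :=
    continuous_uniformAverage.comp
      (continuous_pi fun i => continuous_diracProba.comp (continuous_apply i))
  obtain ⟨A, hA, hAU⟩ := isOpen_pi_iff'.1 (hU.preimage hc) x hx
  obtain ⟨B, hB, hBV⟩ := isOpen_pi_iff'.1 (hV.preimage hc) y hy
  obtain ⟨A', B', hA', hA'n, hB', hB'n, hAB⟩ := h.exists_forall_mem hT Finset.univ
    (fun i => (hA i).1) (fun i => ⟨x i, (hA i).2⟩) (fun i => (hB i).1) (fun i => ⟨y i, (hB i).2⟩)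
  refine (h.isTotallyTransitive hT hTs k hk A' B' hA' hA'n hB' hB'n).mono fun m hm => ?_
  rw [mem_ofPred_eq, ← iterate_mul] at hm ⊢
  choose z hzA hzB using fun i => hAB (k * m) hm i (Finset.mem_univ i)
  refine ⟨uniformAverage fun i => diracProba (z i), hAU fun i _ => hzA i, ?_⟩
  rw [mem_preimage, iterate_TM_uniformAverage]
  simp only [iterate_TM_diracProba]
  exact hBV (a := fun i => T^[k * m] (z i)) fun i _ => hzB i

theorem dense_isPeriodicPoint_TM (hp : AlmostDensePeriodicSets T) :
    Dense {μ | IsPeriodicPoint (TM T hT) μ} := by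
  refine dense_iff_inter_open.2 fun W hW hW' => ?_
  obtain ⟨n, x, hx⟩ := (eventually_exists_uniformAverage_mem hW hW').exists
  have hmem : (fun i : Fin (n + 1) => diracProba (x i)) ∈
      closure (univ.pi fun _ => {μ | IsPeriodicPoint (TM T hT) μ}) := by
    rw [closure_pi_set]
    exact fun i _ => diracProba_mem_closure_isPeriodicPoint hT hp (x i)
  obtain ⟨ν, hνW, hν⟩ := mem_closure_iff.1 hmem _ (hW.preimage continuous_uniformAverage) hx
  choose k hk hkν using fun i => hν i (mem_univ i)
  refine ⟨uniformAverage ν, hνW, ∏ i, k i, Finset.prod_pos fun i _ => hk i, ?_⟩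
  rw [iterate_TM_uniformAverage]
  congr 1
  funext i
  exact IsPeriodicPt.trans_dvd (hkν i) (Finset.dvd_prod_of_mem k (Finset.mem_univ i))

include hT in
/-- An invariant measure giving small mass to a closed set may be replaced by an ergodic one. -/
theorem exists_ergodic_measure_compl_lt {μ : Measure X} [IsProbabilityMeasure μ]
    (hμ : μ.map T = μ) {U : Set X} (hU : IsOpen U) {ε : ℝ} (hμU : μ Uᶜ < ENNReal.ofReal ε) :
    ∃ ν : Measure X, IsProbabilityMeasure ν ∧ Ergodic T ν ∧ ν Uᶜ < ENNReal.ofReal ε := by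
  obtain ⟨V, hUV, hV, hμV⟩ := Set.exists_isOpen_lt_of_lt Uᶜ _ hμU
  obtain ⟨f, hf0, hf1, hf⟩ := exists_continuous_zero_one_of_isClosed hV.isClosed_compl
    hU.isClosed_compl (disjoint_compl_left_iff_subset.2 hUV)
  have hint : ∀ (g : C(X, ℝ)) (ν : Measure X) [IsProbabilityMeasure ν], Integrable g ν :=
    fun g ν _ => g.continuous.integrable_of_hasCompactSupport
      (HasCompactSupport.of_compactSpace g)
  have hcf : Continuous fun ν : ProbabilityMeasure X => integralFunctional ν f :=
    (continuous_apply f).comp continuous_integralFunctional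
  have hclosed : IsClosed {ν : ProbabilityMeasure X | TM T hT ν = ν} :=
    isClosed_eq (continuous_TM hT) continuous_id
  have hμmem : (⟨μ, inferInstance⟩ : ProbabilityMeasure X) ∈ {ν | TM T hT ν = ν} :=
    ProbabilityMeasure.toMeasure_injective hμ
  obtain ⟨ν₀, hν₀, hmin⟩ := hclosed.isCompact.exists_isMinOn ⟨_, hμmem⟩ hcf.continuousOn
  set K : Set (ProbabilityMeasure X) :=
    {ν | TM T hT ν = ν} ∩ {ν | integralFunctional ν f ≤ integralFunctional ν₀ f}
  have hKc : IsCompact K :=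
    (hclosed.inter (isClosed_le hcf continuous_const)).isCompact
  obtain ⟨_, ⟨ν, hνK, rfl⟩, hext⟩ := (hKc.image continuous_integralFunctional).extremePoints_nonempty
    (Set.Nonempty.image _ ⟨ν₀, hν₀, le_refl (integralFunctional ν₀ f)⟩)
  refine ⟨ν, inferInstance, Ergodic.of_mem_extremePoints (mem_extremePoints_iff_left.2
    ⟨⟨⟨hT.measurable, congrArg ProbabilityMeasure.toMeasure hνK.1⟩, inferInstance⟩, ?_⟩), ?_⟩
  · rintro μ₁ ⟨hμ₁, hp₁⟩ μ₂ ⟨hμ₂, hp₂⟩ ⟨a, b, ha, hb, hab, hν⟩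
    have ha' : a ≠ ⊤ := ne_top_of_le_ne_top ENNReal.one_ne_top (hab ▸ le_self_add)
    have hb' : b ≠ ⊤ := ne_top_of_le_ne_top ENNReal.one_ne_top (hab ▸ le_add_self)
    have hapos : 0 < a.toReal := ENNReal.toReal_pos ha.ne' ha'
    have hbpos : 0 < b.toReal := ENNReal.toReal_pos hb.ne' hb'
    have hab' : a.toReal + b.toReal = 1 := by
      rw [← ENNReal.toReal_add ha' hb', hab, ENNReal.toReal_one]
    let ν₁ : ProbabilityMeasure X := ⟨μ₁, hp₁⟩
    let ν₂ : ProbabilityMeasure X := ⟨μ₂, hp₂⟩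
    have hcomb : ∀ g, integralFunctional ν g =
        a.toReal * integralFunctional ν₁ g + b.toReal * integralFunctional ν₂ g := by
      intro g
      simp only [integralFunctional, ← hν, ν₁, ν₂, ProbabilityMeasure.coe_mk]
      rw [integral_add_measure ((hint g μ₁).smul_measure ha') ((hint g μ₂).smul_measure hb'),
        integral_smul_measure, integral_smul_measure, smul_eq_mul, smul_eq_mul]
    have hν₁ : TM T hT ν₁ = ν₁ := ProbabilityMeasure.toMeasure_injective hμ₁.map_eq
    have hν₂ : TM T hT ν₂ = ν₂ := ProbabilityMeasure.toMeasure_injective hμ₂.map_eq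
    have h₁ : integralFunctional ν₀ f ≤ integralFunctional ν₁ f := hmin hν₁
    have h₂ : integralFunctional ν₀ f ≤ integralFunctional ν₂ f := hmin hν₂
    have h₀ : integralFunctional ν f ≤ integralFunctional ν₀ f := hνK.2
    rw [hcomb f] at h₀
    have hK₁ : ν₁ ∈ K := ⟨hν₁, le_of_convexComb_le hapos hbpos.le hab' h₂ h₀⟩
    have hK₂ : ν₂ ∈ K := ⟨hν₂, le_of_convexComb_le hbpos hapos.le (by rwa [add_comm]) h₁
      (by rwa [add_comm])⟩
    have heq := hext (mem_image_of_mem _ hK₁) (mem_image_of_mem _ hK₂)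
      ⟨a.toReal, b.toReal, hapos, hbpos, hab', by
        funext g
        simp [hcomb g]⟩
    exact congrArg ProbabilityMeasure.toMeasure (injective_integralFunctional heq)
  · have hle : ∫ x, f x ∂(ν : Measure X) ≤ ∫ x, f x ∂μ :=
      (show _ ≤ integralFunctional ν₀ f from hνK.2).trans (hmin hμmem)
    have hupper : ∫ x, f x ∂μ ≤ μ.real V := by
      rw [← integral_indicator_one hV.measurableSet]
      refine integral_mono (hint f μ) ((integrable_const 1).indicator hV.measurableSet) fun x => ?_
      by_cases hx : x ∈ V
      · simpa [hx] using (hf x).2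
      · simpa [hx] using (hf0 hx).le
    have hlower : (ν : Measure X).real Uᶜ ≤ ∫ x, f x ∂(ν : Measure X) := by
      rw [← integral_indicator_one hU.measurableSet.compl]
      refine integral_mono ((integrable_const 1).indicator hU.measurableSet.compl)
        (hint f ν) fun x => ?_
      by_cases hx : x ∈ U
      · simpa [hx] using (hf x).1
      · simpa [hx] using (hf1 hx).ge
    rw [← ENNReal.ofReal_toReal (measure_ne_top (ν : Measure X) Uᶜ)]
    exact (ENNReal.ofReal_le_ofReal (hlower.trans (hle.trans hupper))).trans_lt
      (by rwa [measureReal_def, ENNReal.ofReal_toReal (measure_ne_top _ _)])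

end Measures

theorem almost_HY_iff_measures_Psystem {X : Type*}
    [MetricSpace X] [CompactSpace X] [MeasurableSpace X] [BorelSpace X]
    (T : X → X) (hT : Continuous T) (hTs : Surjective T) :
    (IsAlmostHYSystem T ↔
      (IsWeaklyMixing T ∧ ∀ U : Set X, IsOpen U → U.Nonempty → ∀ ε : ℝ, 0 < ε →
        ∃ k : ℕ, 0 < k ∧ ∃ μ : Measure X, IsProbabilityMeasure μ ∧
          Ergodic (T^[k]) μ ∧ μ Uᶜ < ENNReal.ofReal ε)) ∧
    ((IsWeaklyMixing T ∧ ∀ U : Set X, IsOpen U → U.Nonempty → ∀ ε : ℝ, 0 < ε →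
        ∃ k : ℕ, 0 < k ∧ ∃ μ : Measure X, IsProbabilityMeasure μ ∧
          Ergodic (T^[k]) μ ∧ μ Uᶜ < ENNReal.ofReal ε) ↔
      IsPSystem (TM T hT)) ∧
    (IsPSystem (TM T hT) ↔ IsAlmostHYSystem (TM T hT)) := by
  have h₁ : AlmostDensePeriodicSets T → ∀ U : Set X, IsOpen U → U.Nonempty → ∀ ε : ℝ, 0 < ε →
      ∃ k : ℕ, 0 < k ∧ ∃ μ : Measure X, IsProbabilityMeasure μ ∧
        Ergodic (T^[k]) μ ∧ μ Uᶜ < ENNReal.ofReal ε := by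
    intro h U hU hU' ε hε
    obtain ⟨k, hk, μ, _, hμ, hμU⟩ := almostDensePeriodicSets_iff.1 h U hU hU' ε hε
    exact ⟨k, hk, exists_ergodic_measure_compl_lt (hT.iterate k) hμ hU hμU⟩
  have h₂ : (∀ U : Set X, IsOpen U → U.Nonempty → ∀ ε : ℝ, 0 < ε →
      ∃ k : ℕ, 0 < k ∧ ∃ μ : Measure X, IsProbabilityMeasure μ ∧
        Ergodic (T^[k]) μ ∧ μ Uᶜ < ENNReal.ofReal ε) → AlmostDensePeriodicSets T := by
    intro h
    rw [almostDensePeriodicSets_iff]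
    intro U hU hU' ε hε
    obtain ⟨k, hk, μ, hμp, hμ, hμU⟩ := h U hU hU' ε hε
    exact ⟨k, hk, μ, hμp, hμ.map_eq, hμU⟩
  refine ⟨⟨fun h => ⟨h.1.isWeaklyMixing hT hTs h.2, h₁ h.2⟩,
      fun h => ⟨h.1.isTotallyTransitive hT hTs, h₂ h.2⟩⟩,
    ⟨fun h => ⟨h.1.isTotallyTransitive_TM hT hTs 1 one_pos,
        dense_isPeriodicPoint_TM hT (h₂ h.2)⟩,
      fun h => ⟨isWeaklyMixing_of_isTransitive_TM hT hTs h.1,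
        h₁ (almostDensePeriodicSets_of_dense hT h.2)⟩⟩,
    ⟨fun h => ⟨(isWeaklyMixing_of_isTransitive_TM hT hTs h.1).isTotallyTransitive_TM hT hTs,
        .of_dense_isPeriodicPoint (continuous_TM hT) h.2⟩,
      fun h => ⟨h.1 1 one_pos,
        dense_isPeriodicPoint_TM hT (almostDensePeriodicSets_of_TM hT h.2)⟩⟩⟩

end Paper
end
end
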